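/- There is a proper Zariski-closed subset Z of the projective space ℙ¹⁴ of all plane quartics such that for every smooth plane quartic X not in Z, the following holds: if Y is any smooth plane quartic having the same set of 28 bitangent lines as X, then Y = X. In other words, a general smooth plane quartic is uniquely determined by its 28 bitangent lines. -/

import Mathlib

open MvPolynomial

noncomputable section

abbrev P2 : Type := Projectivization ℂ (Fin 3 → ℂ)

/-- The zero locus in `ℙ²` of a polynomial `F`: the points all of whose
representative vectors are zeros of `F`. -/
def curve (F : MvPolynomial (Fin 3) ℂ) : Set P2 :=
  {p | ∀ (w : Fin 3 → ℂ) (hw : w ≠ 0), Projectivization.mk ℂ w hw = p → eval w F = 0}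

/-- The projective line spanned by two vectors. -/
def lineThrough (u v : Fin 3 → ℂ) : Set P2 :=
  {p | ∃ s t : ℂ, ∃ h : s • u + t • v ≠ 0, p = Projectivization.mk ℂ (s • u + t • v) h}

/-- A subset of `ℙ²` is a line if it is the projective span of two
linearly independent vectors. -/
def IsLine (S : Set P2) : Prop :=
  ∃ u v : Fin 3 → ℂ, LinearIndependent ℂ ![u, v] ∧ S = lineThrough u v

/-- The restriction of `F` to the affine parametrization `t ↦ a + t • b` of the line
through `[a]` and `[b]`, as a polynomial in `t`. -/
def lineRest (F : MvPolynomial (Fin 3) ℂ) (a b : Fin 3 → ℂ) : Polynomial ℂ :=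
  eval₂ Polynomial.C (fun i => Polynomial.C (a i) + Polynomial.X * Polynomial.C (b i)) F

/-- The local intersection multiplicity, at the point `[a]`, of the curve `F = 0` with the
line through `[a]` and `[b]` (parametrized by `t ↦ a + t • b`, the point `[a]`
corresponding to `t = 0`). -/
def multAt (F : MvPolynomial (Fin 3) ℂ) (a b : Fin 3 → ℂ) : ℕ :=
  Polynomial.rootMultiplicity 0 (lineRest F a b)

/-- The scheme `X ∩ L` (for `X = {F = 0}`, `L` a line) is everywhere nonreduced: at each
point of `X ∩ L` the local intersection multiplicity is at least `2`.  (Stated over all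
parametrizations of `L`; the base point `a` of a parametrization is a point of `L`, and
every point of `L` occurs as such a base point.) -/
def EverywhereTangent (F : MvPolynomial (Fin 3) ℂ) (S : Set P2) : Prop :=
  ∀ a b : Fin 3 → ℂ, LinearIndependent ℂ ![a, b] → S = lineThrough a b →
    ∀ ha : a ≠ 0, Projectivization.mk ℂ a ha ∈ curve F → 2 ≤ multAt F a b

/-- A theta-line of the quartic `F`: either contained in the curve, or intersecting it
everywhere nonreducedly. -/
def ThetaLine (F : MvPolynomial (Fin 3) ℂ) (S : Set P2) : Prop :=
  IsLine S ∧ (S ⊆ curve F ∨ EverywhereTangent F S)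

/-- A bitangent line of (a smooth curve) `F = 0`: a line, not contained in the curve,
whose scheme-theoretic intersection with the curve is everywhere nonreduced. -/
def Bitangent (F : MvPolynomial (Fin 3) ℂ) (S : Set P2) : Prop :=
  IsLine S ∧ ¬ S ⊆ curve F ∧ EverywhereTangent F S

/-- The line `S` is tangent to the curve `F = 0` at the point `q`: the local intersection
multiplicity there is at least `2`. -/
def TangentAt (F : MvPolynomial (Fin 3) ℂ) (S : Set P2) (q : P2) : Prop :=
  IsLine S ∧ q ∈ S ∧ q ∈ curve F ∧
    ∀ a b : Fin 3 → ℂ, LinearIndependent ℂ ![a, b] → S = lineThrough a b →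
      ∀ ha : a ≠ 0, Projectivization.mk ℂ a ha = q → 2 ≤ multAt F a b

/-- The curve `F = 0` is smooth: `F` and its partial derivatives have no common
projective zero. -/
def SmoothCurve (F : MvPolynomial (Fin 3) ℂ) : Prop :=
  ∀ w : Fin 3 → ℂ, w ≠ 0 → ¬ (eval w F = 0 ∧ ∀ i : Fin 3, eval w (pderiv i F) = 0)

/-- Iterated partial derivative along a list of coordinate directions. -/
def pderivList (l : List (Fin 3)) (F : MvPolynomial (Fin 3) ℂ) : MvPolynomial (Fin 3) ℂ :=
  l.foldr (fun i G => pderiv i G) F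

/-- `F` vanishes to order at least `m` at the point `p` (all partial derivatives of
order `< m` vanish at `p`); i.e. `p` is a point of multiplicity at least `m` of `F = 0`. -/
def VanishesToOrder (F : MvPolynomial (Fin 3) ℂ) (p : P2) (m : ℕ) : Prop :=
  ∀ l : List (Fin 3), l.length < m →
    ∀ (w : Fin 3 → ℂ) (hw : w ≠ 0), Projectivization.mk ℂ w hw = p →
      eval w (pderivList l F) = 0

/-- `p` is a singular point of the curve `F = 0`. -/
def IsSingularAt (F : MvPolynomial (Fin 3) ℂ) (p : P2) : Prop :=
  VanishesToOrder F p 2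

/-- `p` is a double point: a point of multiplicity exactly `2`. -/
def IsDoublePoint (F : MvPolynomial (Fin 3) ℂ) (p : P2) : Prop :=
  VanishesToOrder F p 2 ∧ ¬ VanishesToOrder F p 3

/-- The quadratic form (in the direction `b`) cutting out the tangent cone of `F = 0`
at the double point `[a]`: the degree-`2` Taylor coefficient of `t ↦ F (a + t • b)`. -/
def coneCoeff (F : MvPolynomial (Fin 3) ℂ) (a b : Fin 3 → ℂ) : ℂ :=
  (lineRest F a b).coeff 2

/-- `p` is an ordinary node: a double point whose tangent cone consists of two distinct
lines, i.e. the tangent-cone quadratic has two null directions independent modulo `a`. -/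
def OrdinaryNode (F : MvPolynomial (Fin 3) ℂ) (p : P2) : Prop :=
  IsDoublePoint F p ∧
    ∀ (a : Fin 3 → ℂ) (ha : a ≠ 0), Projectivization.mk ℂ a ha = p →
      ∃ b₁ b₂ : Fin 3 → ℂ, LinearIndependent ℂ ![a, b₁, b₂] ∧
        coneCoeff F a b₁ = 0 ∧ coneCoeff F a b₂ = 0

/-- At the double point `[a]`, the tangent cone is the double line through `[a]` and
`[b₀]`: `b₀` is a null direction of the tangent-cone quadratic, and every null
direction lies on the line spanned by `a` and `b₀`. -/
def DoubleLineCone (F : MvPolynomial (Fin 3) ℂ) (a b₀ : Fin 3 → ℂ) : Prop :=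
  LinearIndependent ℂ ![a, b₀] ∧ coneCoeff F a b₀ = 0 ∧
    ∀ b : Fin 3 → ℂ, coneCoeff F a b = 0 → b ∈ Submodule.span ℂ ({a, b₀} : Set (Fin 3 → ℂ))

/-- `p` is an ordinary cusp: a double point whose tangent cone is a double line `L₀`
with local intersection multiplicity `i(L₀ · X) = 3` at `p`. -/
def OrdinaryCusp (F : MvPolynomial (Fin 3) ℂ) (p : P2) : Prop :=
  IsDoublePoint F p ∧
    ∀ (a : Fin 3 → ℂ) (ha : a ≠ 0), Projectivization.mk ℂ a ha = p →
      ∃ b₀ : Fin 3 → ℂ, DoubleLineCone F a b₀ ∧ multAt F a b₀ = 3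

/-- `p` is an ordinary tacnode: a double point whose tangent cone is a double line `L₀`
with local intersection multiplicity `i(L₀ · X) = 4` at `p`. -/
def OrdinaryTacnode (F : MvPolynomial (Fin 3) ℂ) (p : P2) : Prop :=
  IsDoublePoint F p ∧
    ∀ (a : Fin 3 → ℂ) (ha : a ≠ 0), Projectivization.mk ℂ a ha = p →
      ∃ b₀ : Fin 3 → ℂ, DoubleLineCone F a b₀ ∧ multAt F a b₀ = 4

/-- A theta-line of type `i`: a theta-line, not a component of the curve, containing
exactly `i` singular points of the curve. -/
def ThetaLineOfType (F : MvPolynomial (Fin 3) ℂ) (i : ℕ) (S : Set P2) : Prop :=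
  ThetaLine F S ∧ ¬ S ⊆ curve F ∧ {p | p ∈ S ∧ IsSingularAt F p}.ncard = i

/-- Three points of `ℙ²` are collinear. -/
def Collin (p q r : P2) : Prop :=
  ∃ S : Set P2, IsLine S ∧ p ∈ S ∧ q ∈ S ∧ r ∈ S


/-- An ordinary bitangent: a bitangent meeting the curve at exactly two distinct points,
each with local intersection multiplicity exactly `2`. -/
def OrdinaryBitangent (F : MvPolynomial (Fin 3) ℂ) (S : Set P2) : Prop :=
  Bitangent F S ∧ (S ∩ curve F).ncard = 2 ∧
    ∀ a b : Fin 3 → ℂ, LinearIndependent ℂ ![a, b] → S = lineThrough a b →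
      ∀ ha : a ≠ 0, Projectivization.mk ℂ a ha ∈ curve F → multAt F a b = 2

/-- A bitangent meeting the curve only at smooth points. -/
def SmoothBitangent (F : MvPolynomial (Fin 3) ℂ) (S : Set P2) : Prop :=
  Bitangent F S ∧ ∀ p ∈ S ∩ curve F, ¬ IsSingularAt F p

/-- The seven points of the Cayley octad attached to the parameters `θ`: the four coordinate
points and three more points in the chart where the last coordinate is `1`. -/
def octadPt {R : Type*} [CommRing R] (θ : Fin 18 → R) : Fin 7 → Fin 4 → R :=
  ![![1, 0, 0, 0], ![0, 1, 0, 0], ![0, 0, 1, 0], ![0, 0, 0, 1],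
    ![θ 0, θ 1, θ 2, 1], ![θ 3, θ 4, θ 5, 1], ![θ 6, θ 7, θ 8, 1]]

/-- The determinant with rows `a`, `b`, `c`. -/
def det3 {R : Type*} [CommRing R] (a b c : Fin 3 → R) : R :=
  a 0 * (b 1 * c 2 - b 2 * c 1) - a 1 * (b 0 * c 2 - b 2 * c 0)
    + a 2 * (b 0 * c 1 - b 1 * c 0)

/-- The determinant with rows `a`, `b`, `c`, `d`. -/
def det4 {R : Type*} [CommRing R] (a b c d : Fin 4 → R) : R :=
  a 0 * det3 ![b 1, b 2, b 3] ![c 1, c 2, c 3] ![d 1, d 2, d 3]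
    - a 1 * det3 ![b 0, b 2, b 3] ![c 0, c 2, c 3] ![d 0, d 2, d 3]
    + a 2 * det3 ![b 0, b 1, b 3] ![c 0, c 1, c 3] ![d 0, d 1, d 3]
    - a 3 * det3 ![b 0, b 1, b 2] ![c 0, c 1, c 2] ![d 0, d 1, d 2]

/-- The determinant of the affine coordinates of the last three octad points. -/
def octadDet {R : Type*} [CommRing R] (θ : Fin 18 → R) : R :=
  det3 ![θ 0, θ 1, θ 2] ![θ 3, θ 4, θ 5] ![θ 6, θ 7, θ 8]

/-- The last column of the quadric through the octad with the given leading entries. -/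
def netCol {R : Type*} [CommRing R] (θ : Fin 18 → R) (x y z : R) : Fin 3 → R :=
  let r₀ := θ 0 * θ 1 * x + θ 0 * θ 2 * y + θ 1 * θ 2 * z
  let r₁ := θ 3 * θ 4 * x + θ 3 * θ 5 * y + θ 4 * θ 5 * z
  let r₂ := θ 6 * θ 7 * x + θ 6 * θ 8 * y + θ 7 * θ 8 * z
  ![-((θ 4 * θ 8 - θ 5 * θ 7) * r₀ + (θ 2 * θ 7 - θ 1 * θ 8) * r₁
        + (θ 1 * θ 5 - θ 2 * θ 4) * r₂),
    -((θ 5 * θ 6 - θ 3 * θ 8) * r₀ + (θ 0 * θ 8 - θ 2 * θ 6) * r₁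
        + (θ 2 * θ 3 - θ 0 * θ 5) * r₂),
    -((θ 3 * θ 7 - θ 4 * θ 6) * r₀ + (θ 1 * θ 6 - θ 0 * θ 7) * r₁
        + (θ 0 * θ 4 - θ 1 * θ 3) * r₂)]

/-- The quadric through the octad with leading entries proportional to `x`, `y`, `z`. -/
def quadricMat {R : Type*} [CommRing R] (θ : Fin 18 → R) (x y z : R) :
    Matrix (Fin 4) (Fin 4) R :=
  let t := netCol θ x y z
  let D := octadDet θ
  ![![0, D * x, D * y, t 0], ![D * x, 0, D * z, t 1], ![D * y, D * z, 0, t 2],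
    ![t 0, t 1, t 2, 0]]

/-- The `m`-th generator of the net of quadrics through the octad. -/
def netMat {R : Type*} [CommRing R] (θ : Fin 18 → R) (m : Fin 3) : Matrix (Fin 4) (Fin 4) R :=
  quadricMat θ (![θ 9, θ 10, θ 11] m) (![θ 12, θ 13, θ 14] m) (![θ 15, θ 16, θ 17] m)

/-- The covector of the line joining the `i`-th and the `j`-th octad point. -/
def lineCov {R : Type*} [CommRing R] (θ : Fin 18 → R) (i j : Fin 7) (m : Fin 3) : R :=
  ∑ u, ∑ v, octadPt θ i u * netMat θ m u v * octadPt θ j v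

section naturality
variable {R S : Type*} [CommRing R] [CommRing S] (σ : R →+* S) (θ : Fin 18 → R)

theorem map_octadPt (i u) : octadPt (σ ∘ θ) i u = σ (octadPt θ i u) := by
  fin_cases i <;> fin_cases u <;> simp [octadPt]

theorem map_det3 (a b c : Fin 3 → R) : det3 (σ ∘ a) (σ ∘ b) (σ ∘ c) = σ (det3 a b c) := by
  simp [det3]

theorem map_det4 (a b c d : Fin 4 → R) :
    det4 (σ ∘ a) (σ ∘ b) (σ ∘ c) (σ ∘ d) = σ (det4 a b c d) := by
  simp [det4, det3]

theorem map_quadricMat (x y z : R) (u v) :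
    quadricMat (σ ∘ θ) (σ x) (σ y) (σ z) u v = σ (quadricMat θ x y z u v) := by
  fin_cases u <;> fin_cases v <;> simp [quadricMat, octadDet, det3, netCol]

theorem map_netMat (m u v) : netMat (σ ∘ θ) m u v = σ (netMat θ m u v) := by
  rw [netMat, netMat, ← map_quadricMat]
  fin_cases m <;> simp

theorem map_lineCov (i j m) : lineCov (σ ∘ θ) i j m = σ (lineCov θ i j m) := by
  simp [lineCov, map_octadPt, map_netMat]

end naturality

theorem lineCov_comm {R : Type*} [CommRing R] (θ : Fin 18 → R) (i j : Fin 7) :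
    lineCov θ i j = lineCov θ j i := by
  funext m
  simp only [lineCov]
  rw [Finset.sum_comm]
  refine Finset.sum_congr rfl fun u _ => Finset.sum_congr rfl fun v _ => ?_
  have : netMat θ m u v = netMat θ m v u := by
    fin_cases u <;> fin_cases v <;> simp [netMat, quadricMat]
  rw [this]; ring

theorem lineCov_self {R : Type*} [CommRing R] (θ : Fin 18 → R) (i : Fin 7) :
    lineCov θ i i = 0 := by
  funext m
  fin_cases i <;> simp [lineCov, octadPt, Fin.sum_univ_succ, netMat, quadricMat, netCol, octadDet, det3] <;>
    ring

/-- The edges of the complete graph on the octad points. -/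
abbrev Edge : Type := {p : Fin 7 × Fin 7 // p.1 < p.2}

abbrev edgeCov {R : Type*} [CommRing R] (θ : Fin 18 → R) (e : Edge) : Fin 3 → R :=
  lineCov θ e.1.1 e.1.2

/-- The vertices not on the edges `e` and `f`. -/
def restVertices (e f : Edge) : List (Fin 7) :=
  (List.finRange 7).filter fun i => i ≠ e.1.1 ∧ i ≠ e.1.2 ∧ i ≠ f.1.1 ∧ i ≠ f.1.2

def mkEdge (i j : Fin 7) : Edge :=
  if h : i < j then ⟨(i, j), h⟩ else if h : j < i then ⟨(j, i), h⟩ else ⟨(0, 1), by decide⟩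

/-- The three pairs of disjoint edges on the vertices not on `e` and `f`. -/
def restEdges (e f : Edge) : Fin 3 → Fin 2 → Edge :=
  let L := restVertices e f
  let a := L.getD 0 0
  let b := L.getD 1 0
  let c := L.getD 2 0
  let d := L.getD 3 0
  ![![mkEdge a b, mkEdge c d], ![mkEdge a c, mkEdge b d], ![mkEdge a d, mkEdge b c]]

abbrev EdgeDisj (e f : Edge) : Prop :=
  e.1.1 ≠ f.1.1 ∧ e.1.1 ≠ f.1.2 ∧ e.1.2 ≠ f.1.1 ∧ e.1.2 ≠ f.1.2

theorem restEdges_spec : ∀ e f : Edge, e ≠ f → ¬ EdgeDisj e f → ∀ i : Fin 3,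
    EdgeDisj (restEdges e f i 0) (restEdges e f i 1) ∧
    ∀ k : Fin 2, EdgeDisj e (restEdges e f i k) ∧ EdgeDisj f (restEdges e f i k) := by
  decide +kernel

def apply3 {R : Type*} [CommRing R] (l v : Fin 3 → R) : R := l 0 * v 0 + l 1 * v 1 + l 2 * v 2

/-- Values of four products of lines at a point. -/
def pairValues {R : Type*} [CommRing R] (θ : Fin 18 → R) (e f : Edge) (v : Fin 3 → R) :
    Fin 4 → R :=
  ![apply3 (edgeCov θ e) v * apply3 (edgeCov θ f) v,
    apply3 (edgeCov θ (restEdges e f 0 0)) v * apply3 (edgeCov θ (restEdges e f 0 1)) v,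
    apply3 (edgeCov θ (restEdges e f 1 0)) v * apply3 (edgeCov θ (restEdges e f 1 1)) v,
    apply3 (edgeCov θ (restEdges e f 2 0)) v * apply3 (edgeCov θ (restEdges e f 2 1)) v]

def pairDet {R : Type*} [CommRing R] (θ : Fin 18 → R) (e f : Edge) : R :=
  det4 (pairValues θ e f ![1, 0, 0]) (pairValues θ e f ![0, 1, 0]) (pairValues θ e f ![0, 0, 1])
    (pairValues θ e f ![1, 1, 1])

def genericParam : Fin 18 → ℤ := ![-1, -4, -2, -2, 1, 4, 4, 3, 1, 3, -2, -1, 4, -4, 2, 1, 0, 1]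

def chordParam : Fin 18 → ℤ := ![5, 10, 6, 8, 15, 8, 10, 18, 9, -6, -5, -1, 30, 40, 10, -10, -15, -5]

theorem genericParam_line : ∀ e : Edge, edgeCov genericParam e 2 ≠ 0 := by
  decide +kernel

theorem chordParam_line : ∀ e : Edge, edgeCov chordParam e 2 ≠ 0 ∧
   edgeCov chordParam e 1 = - edgeCov chordParam e 2 * ((e.1.1 : ℕ) - 3 + ((e.1.2 : ℕ) - 3)) ∧
   edgeCov chordParam e 0 = edgeCov chordParam e 2 * (((e.1.1 : ℕ) - 3) * ((e.1.2 : ℕ) - 3)) := by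
  decide +kernel

/-- The smallest vertex not on the edge. -/
def thirdVertex (e : Edge) : Fin 7 := (restVertices e e).getD 0 0

/-- The second smallest vertex not on the edge. -/
def fourthVertex (e : Edge) : Fin 7 := (restVertices e e).getD 1 0

theorem genericParam_octad : ∀ e : Edge,
    det4 (octadPt genericParam e.1.1) (octadPt genericParam e.1.2)
      (octadPt genericParam (thirdVertex e)) (octadPt genericParam (fourthVertex e)) ≠ 0 := by
  decide +kernel

theorem genericParam_pairDet : ∀ e f : Edge, e ≠ f → ¬ EdgeDisj e f →
   pairDet genericParam e f ≠ 0 := by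
  decide +kernel

theorem genericParam_noConc : ∀ e f g : Edge, e ≠ f → e ≠ g → f ≠ g →
    det3 (edgeCov genericParam e) (edgeCov genericParam f) (edgeCov genericParam g) ≠ 0 := by
  decide +kernel

/-- A function on `ℂ³` given by a homogeneous polynomial of degree `d`. -/
def IsForm (d : ℕ) (f : (Fin 3 → ℂ) → ℂ) : Prop :=
  ∃ p : MvPolynomial (Fin 3) ℂ, p.IsHomogeneous d ∧ ∀ v, f v = eval v p

namespace IsForm

variable {d e : ℕ} {f g : (Fin 3 → ℂ) → ℂ}

theorem add (hf : IsForm d f) (hg : IsForm d g) : IsForm d fun v => f v + g v := by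
  obtain ⟨p, hp, hf⟩ := hf
  obtain ⟨q, hq, hg⟩ := hg
  exact ⟨p + q, hp.add hq, fun v => by simp [hf, hg]⟩

theorem mul (hf : IsForm d f) (hg : IsForm e g) : IsForm (d + e) fun v => f v * g v := by
  obtain ⟨p, hp, hf⟩ := hf
  obtain ⟨q, hq, hg⟩ := hg
  exact ⟨p * q, hp.mul hq, fun v => by simp [hf, hg]⟩

theorem const_mul (c : ℂ) (hf : IsForm d f) : IsForm d fun v => c * f v := by
  obtain ⟨p, hp, hf⟩ := hf
  refine ⟨C c * p, by simpa using (isHomogeneous_C (Fin 3) c).mul hp, fun v => by simp [hf]⟩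

theorem sub (hf : IsForm d f) (hg : IsForm d g) : IsForm d fun v => f v - g v := by
  simpa [sub_eq_add_neg] using hf.add (hg.const_mul (-1))

theorem sq (hf : IsForm d f) : IsForm (d + d) fun v => f v ^ 2 := by
  simpa [pow_two] using hf.mul hf

theorem zero (d : ℕ) : IsForm d fun _ => 0 :=
  ⟨0, isHomogeneous_zero _ _ d, by simp⟩

theorem coord (i : Fin 3) : IsForm 1 fun v => v i :=
  ⟨X i, isHomogeneous_X _ _, by simp⟩

theorem linear (l : (Fin 3 → ℂ) →ₗ[ℂ] ℂ) : IsForm 1 l := by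
  refine ⟨∑ i, C (l (Pi.single i 1)) * X i, IsHomogeneous.sum _ _ _ fun i _ => by
    simpa using (isHomogeneous_C (Fin 3) _).mul (isHomogeneous_X ℂ i), fun v => ?_⟩
  rw [LinearMap.pi_apply_eq_sum_univ l v]
  simp only [map_sum, map_mul, eval_C, eval_X, smul_eq_mul, mul_comm]
  congr! 4 with i
  simp [Pi.single_apply, eq_comm]

theorem comp (hf : IsForm d f) (T : (Fin 3 → ℂ) →ₗ[ℂ] (Fin 3 → ℂ)) :
    IsForm d fun v => f (T v) := by
  obtain ⟨p, hp, hf⟩ := hf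
  choose q hq hT using fun i => linear ((LinearMap.proj i).comp T)
  refine ⟨bind₁ q p, by simpa using hp.aeval q hq, fun v => ?_⟩
  simp only [hf, ← coe_aeval_eq_eval, RingHom.coe_coe, aeval_bind₁]
  congr 2
  funext i
  simpa [coe_aeval_eq_eval] using hT i v

end IsForm

/-- The exponent vector with the given entries. -/
def expo (i j k : ℕ) : Fin 3 →₀ ℕ := Finsupp.equivFunOnFinite.symm ![i, j, k]

theorem IsForm.eval_eq_sum {d : ℕ} {p : MvPolynomial (Fin 3) ℂ} (hp : p.IsHomogeneous d)
    (v : Fin 3 → ℂ) :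
    eval v p = ∑ i ∈ Finset.range (d + 1), ∑ j ∈ Finset.range (d + 1 - i),
      coeff (expo i j (d - i - j)) p * (v 0 ^ i * v 1 ^ j * v 2 ^ (d - i - j)) := by
  classical
  rw [Finset.sum_sigma', eval_eq']
  have hinj : Set.InjOn (fun x : (_ : ℕ) × ℕ => expo x.1 x.2 (d - x.1 - x.2))
      ((Finset.range (d + 1)).sigma fun i => Finset.range (d + 1 - i)) := by
    rintro ⟨i, j⟩ - ⟨i', j'⟩ - h
    have h := Finsupp.equivFunOnFinite.symm.injective h
    have h0 := congrFun h 0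
    have h1 := congrFun h 1
    simp at h0 h1
    simp [h0, h1]
  have hs : p.support ⊆ ((Finset.range (d + 1)).sigma fun i => Finset.range (d + 1 - i)).image
      (fun x : (_ : ℕ) × ℕ => expo x.1 x.2 (d - x.1 - x.2)) := by
    intro m hm
    have hd : m 0 + m 1 + m 2 = d := by
      have := hp.coeff_eq_zero (d := m)
      by_contra h
      refine mem_support_iff.1 hm (this ?_)
      rwa [Finsupp.degree_eq_sum, Fin.sum_univ_three]
    refine Finset.mem_image.2 ⟨⟨m 0, m 1⟩, by simp; omega, ?_⟩
    ext i
    fin_cases i <;> simp [expo]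
    omega
  rw [Finset.sum_subset hs, Finset.sum_image hinj]
  · refine Finset.sum_congr rfl fun x _ => ?_
    simp [expo, Fin.prod_univ_three]
  · intro m _ hm
    simp [notMem_support_iff.1 hm]

namespace IsForm

variable {d e : ℕ} {f g : (Fin 3 → ℂ) → ℂ}

theorem exists_coeff (hf : IsForm d f) :
    ∃ c : ℕ → ℕ → ℂ, ∀ v, f v = ∑ i ∈ Finset.range (d + 1), ∑ j ∈ Finset.range (d + 1 - i),
      c i j * (v 0 ^ i * v 1 ^ j * v 2 ^ (d - i - j)) := by
  obtain ⟨p, hp, hf⟩ := hf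
  exact ⟨_, fun v => (hf v).trans (eval_eq_sum hp v)⟩

theorem smul (hf : IsForm d f) (c : ℂ) (v : Fin 3 → ℂ) : f (c • v) = c ^ d * f v := by
  obtain ⟨a, ha⟩ := hf.exists_coeff
  simp only [ha, Finset.mul_sum]
  refine Finset.sum_congr rfl fun i hi => Finset.sum_congr rfl fun j hj => ?_
  have : d = i + j + (d - i - j) := by simp at hi hj; omega
  conv_rhs => rw [this, pow_add, pow_add]
  simp only [Pi.smul_apply, smul_eq_mul, mul_pow]
  rw [← this]
  ring

theorem eq_zero_or_eq_zero (hf : IsForm d f) (hg : IsForm e g) (h : ∀ v, f v * g v = 0) :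
    (∀ v, f v = 0) ∨ ∀ v, g v = 0 := by
  obtain ⟨p, hp, hf⟩ := hf
  obtain ⟨q, hq, hg⟩ := hg
  have : p * q = 0 := MvPolynomial.funext fun v => by simpa [hf, hg] using h v
  rcases mul_eq_zero.1 this with h | h
  · left; simp [hf, h]
  · right; simp [hg, h]

end IsForm

theorem apply3_smul (l v : Fin 3 → ℂ) (c : ℂ) : apply3 l (c • v) = c * apply3 l v := by
  simp [apply3]; ring

@[simp]
theorem apply3_zero (l : Fin 3 → ℂ) : apply3 l 0 = 0 := by
  simp [apply3]

theorem isForm_apply3 (l : Fin 3 → ℂ) : IsForm 1 (apply3 l) := by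
  have := (((IsForm.coord 0).const_mul (l 0)).add ((IsForm.coord 1).const_mul (l 1))).add
    ((IsForm.coord 2).const_mul (l 2))
  exact this

/-- Coordinates adapted to three non-concurrent lines. -/
theorem exists_frame {a b c : Fin 3 → ℂ} (h : det3 a b c ≠ 0) :
    ∃ T S : (Fin 3 → ℂ) →ₗ[ℂ] (Fin 3 → ℂ),
      (∀ w, apply3 a (T w) = w 0 ∧ apply3 b (T w) = w 1 ∧ apply3 c (T w) = w 2) ∧
      (∀ v, S v 0 = apply3 a v ∧ S v 1 = apply3 b v ∧ S v 2 = apply3 c v) ∧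
      ∀ v, T (S v) = v := by
  set M : Matrix (Fin 3) (Fin 3) ℂ := Matrix.of ![a, b, c] with hM
  have hdet : IsUnit M.det := by
    rw [isUnit_iff_ne_zero]
    convert h using 1
    rw [Matrix.det_fin_three]
    simp [M, det3]
    ring
  have hS : ∀ v, M.toLin' v 0 = apply3 a v ∧ M.toLin' v 1 = apply3 b v ∧
      M.toLin' v 2 = apply3 c v := by
    intro v
    simp [M, apply3, Matrix.mulVec, dotProduct, Fin.sum_univ_three]
  refine ⟨M⁻¹.toLin', M.toLin', fun w => ?_, hS, fun v => ?_⟩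
  · have : M.toLin' (M⁻¹.toLin' w) = w := by
      simp [Matrix.mul_nonsing_inv _ hdet]
    have h2 := hS (M⁻¹.toLin' w)
    rw [this] at h2
    exact ⟨h2.1.symm, h2.2.1.symm, h2.2.2.symm⟩
  · simp [Matrix.nonsing_inv_mul _ hdet]

theorem eq_zero_of_det3_ne_zero {a b c v : Fin 3 → ℂ} (h : det3 a b c ≠ 0) (ha : apply3 a v = 0)
    (hb : apply3 b v = 0) (hc : apply3 c v = 0) : v = 0 := by
  obtain ⟨T, S, -, hS, hTS⟩ := exists_frame h
  have : S v = 0 := by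
    ext i; fin_cases i <;> simp [hS, ha, hb, hc]
  rw [← hTS v, this, map_zero]

/-- Annihilate some of the coordinates. -/
def maskLin (s : Fin 3 → ℂ) : (Fin 3 → ℂ) →ₗ[ℂ] (Fin 3 → ℂ) where
  toFun w i := s i * w i
  map_add' v w := by ext i; simp [mul_add]
  map_smul' c w := by ext i; simp [mul_left_comm]

theorem maskLin_apply (s w : Fin 3 → ℂ) (i : Fin 3) : maskLin s w i = s i * w i := rfl

namespace IsForm

variable {d e : ℕ} {f g : (Fin 3 → ℂ) → ℂ}

theorem sum {ι : Type*} (s : Finset ι) (f : ι → (Fin 3 → ℂ) → ℂ) (hf : ∀ i ∈ s, IsForm d (f i)) :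
    IsForm d fun v => ∑ i ∈ s, f i v := by
  classical
  induction s using Finset.induction_on with
  | empty => simpa using zero d
  | insert a s ha ih =>
    simp only [Finset.sum_insert ha]
    exact (hf a (Finset.mem_insert_self a s)).add
      (ih fun i hi => hf i (Finset.mem_insert_of_mem hi))

theorem monom (i j k : ℕ) (c : ℂ) : IsForm (i + j + k) fun v => c * (v 0 ^ i * v 1 ^ j * v 2 ^ k) := by
  refine IsForm.const_mul c ⟨X 0 ^ i * X 1 ^ j * X 2 ^ k, ?_, by simp⟩
  exact ((isHomogeneous_X_pow _ _).mul (isHomogeneous_X_pow _ _)).mul (isHomogeneous_X_pow _ _)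

theorem of_deg_zero (hf : IsForm 0 f) : ∃ c, ∀ v, f v = c := by
  obtain ⟨a, ha⟩ := hf.exists_coeff
  exact ⟨a 0 0, fun v => by simp [ha]⟩

/-- A form vanishing on a line is divisible by the equation of the line. -/
theorem exists_eq_line_mul {a b c : Fin 3 → ℂ} (h : det3 a b c ≠ 0) (hf : IsForm (d + 1) f)
    (h0 : ∀ v, apply3 a v = 0 → f v = 0) :
    ∃ g, IsForm d g ∧ ∀ v, f v = apply3 a v * g v := by
  obtain ⟨T, S, hT, hS, hTS⟩ := exists_frame h
  obtain ⟨k, hk⟩ := (hf.comp T).exists_coeff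
  have hz : ∀ w : Fin 3 → ℂ, ∑ j ∈ Finset.range (d + 1 + 1 - 0),
      k 0 j * (w 0 ^ 0 * w 1 ^ j * w 2 ^ (d + 1 - 0 - j)) = 0 := by
    intro w
    have h1 := hk ![0, w 1, w 2]
    rw [h0 _ (by rw [(hT _).1]; simp), Finset.sum_range_succ'] at h1
    simpa using h1.symm
  refine ⟨fun v => ∑ i ∈ Finset.range (d + 1), ∑ j ∈ Finset.range (d + 1 - i),
    k (i + 1) j * (S v 0 ^ i * S v 1 ^ j * S v 2 ^ (d - i - j)), ?_, fun v => ?_⟩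
  · refine IsForm.sum _ _ fun i hi => IsForm.sum _ _ fun j hj => ?_
    have : d = i + j + (d - i - j) := by simp at hi hj; omega
    have h2 := (monom i j (d - i - j) (k (i + 1) j)).comp S
    rwa [← this] at h2
  · have h1 := hk (S v)
    rw [hTS, Finset.sum_range_succ', hz (S v), add_zero] at h1
    rw [h1, ← (hS v).1]
    simp only [Finset.mul_sum]
    refine Finset.sum_congr rfl fun i _ => ?_
    have e1 : d + 1 + 1 - (i + 1) = d + 1 - i := by omega
    have e2 : ∀ j, d + 1 - (i + 1) - j = d - i - j := by intro j; omega
    simp only [e1, e2, pow_succ]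
    exact Finset.sum_congr rfl fun j _ => by ring

theorem vanish_of_mul {a b c : Fin 3 → ℂ} (h : det3 a b c ≠ 0) (hg : IsForm d g)
    (h0 : ∀ v, apply3 b v = 0 → apply3 a v * g v = 0) :
    ∀ v, apply3 b v = 0 → g v = 0 := by
  obtain ⟨T, S, hT, hS, hTS⟩ := exists_frame h
  set Q := T.comp ((maskLin ![1, 0, 1]).comp S)
  have hb : ∀ v, apply3 b (Q v) = 0 := fun v => by
    simp [Q, hT, maskLin_apply]
  rcases eq_zero_or_eq_zero ((isForm_apply3 a).comp Q) (hg.comp Q) (fun v => h0 _ (hb v))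
    with h1 | h1
  · have := h1 (T ![1, 0, 0])
    simp [Q, hT, hS, maskLin_apply] at this
  · intro v hv
    have : Q v = v := by
      conv_rhs => rw [← hTS v]
      simp only [Q, LinearMap.comp_apply]
      congr 1
      ext i
      fin_cases i <;> simp [maskLin_apply, hS, hv]
    rw [← this]
    exact h1 v

/-- Interpolation of three forms on the sides of a triangle, compatible at the vertices. -/
theorem exists_interpolation {a b c : Fin 3 → ℂ} (h : det3 a b c ≠ 0)
    {q₀ q₁ q₂ : (Fin 3 → ℂ) → ℂ} (h₀ : IsForm (d + 1) q₀) (h₁ : IsForm (d + 1) q₁)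
    (h₂ : IsForm (d + 1) q₂)
    (h01 : ∀ v, apply3 a v = 0 → apply3 b v = 0 → q₀ v = q₁ v)
    (h02 : ∀ v, apply3 a v = 0 → apply3 c v = 0 → q₀ v = q₂ v)
    (h12 : ∀ v, apply3 b v = 0 → apply3 c v = 0 → q₁ v = q₂ v) :
    ∃ Q, IsForm (d + 1) Q ∧ (∀ v, apply3 a v = 0 → Q v = q₀ v) ∧
      (∀ v, apply3 b v = 0 → Q v = q₁ v) ∧ ∀ v, apply3 c v = 0 → Q v = q₂ v := by
  obtain ⟨T, S, hT, hS, hTS⟩ := exists_frame h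
  set P : (Fin 3 → ℂ) → (Fin 3 → ℂ) →ₗ[ℂ] (Fin 3 → ℂ) := fun s => T.comp ((maskLin s).comp S)
    with hP
  have hPa : ∀ s v, apply3 a (P s v) = s 0 * apply3 a v := fun s v => by
    simp [P, hT, hS, maskLin_apply]
  have hPb : ∀ s v, apply3 b (P s v) = s 1 * apply3 b v := fun s v => by
    simp [P, hT, hS, maskLin_apply]
  have hPc : ∀ s v, apply3 c (P s v) = s 2 * apply3 c v := fun s v => by
    simp [P, hT, hS, maskLin_apply]
  have hext : ∀ u v, apply3 a u = apply3 a v → apply3 b u = apply3 b v →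
      apply3 c u = apply3 c v → u = v := by
    intro u v ha hb hc
    rw [← hTS u, ← hTS v]
    congr 1
    ext i
    fin_cases i <;> simp [hS, ha, hb, hc]
  have hz : ∀ {q}, IsForm (d + 1) q → q 0 = 0 := fun hq => by
    simpa using hq.smul 0 0
  refine ⟨fun v => q₀ (P ![0, 1, 1] v) + q₁ (P ![1, 0, 1] v) + q₂ (P ![1, 1, 0] v)
    - q₀ (P ![0, 0, 1] v) - q₁ (P ![1, 0, 0] v) - q₂ (P ![0, 1, 0] v),
    (((((h₀.comp _).add (h₁.comp _)).add (h₂.comp _)).sub (h₀.comp _)).sub (h₁.comp _)).sub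
      (h₂.comp _), fun v hv => ?_, fun v hv => ?_, fun v hv => ?_⟩
  · beta_reduce
    rw [hext (P ![0, 1, 1] v) v (by simp [hPa, hv]) (by simp [hPb]) (by simp [hPc]),
      hext (P ![1, 0, 1] v) (P ![0, 0, 1] v) (by simp [hPa, hv]) (by simp [hPb]) (by simp [hPc]),
      hext (P ![1, 1, 0] v) (P ![0, 1, 0] v) (by simp [hPa, hv]) (by simp [hPb]) (by simp [hPc]),
      hext (P ![1, 0, 0] v) 0 (by simp [hPa, hv]) (by simp [hPb])
        (by simp [hPc]), hz h₁, h01 (P ![0, 0, 1] v) (by simp [hPa]) (by simp [hPb])]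
    ring
  · beta_reduce
    rw [hext (P ![1, 0, 1] v) v (by simp [hPa]) (by simp [hPb, hv]) (by simp [hPc]),
      hext (P ![0, 1, 1] v) (P ![0, 0, 1] v) (by simp [hPa]) (by simp [hPb, hv]) (by simp [hPc]),
      hext (P ![1, 1, 0] v) (P ![1, 0, 0] v) (by simp [hPa]) (by simp [hPb, hv]) (by simp [hPc]),
      hext (P ![0, 1, 0] v) 0 (by simp [hPa]) (by simp [hPb, hv])
        (by simp [hPc]), hz h₂, h12 (P ![1, 0, 0] v) (by simp [hPb]) (by simp [hPc])]
    ring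
  · beta_reduce
    rw [hext (P ![1, 1, 0] v) v (by simp [hPa]) (by simp [hPb]) (by simp [hPc, hv]),
      hext (P ![0, 1, 1] v) (P ![0, 1, 0] v) (by simp [hPa]) (by simp [hPb]) (by simp [hPc, hv]),
      hext (P ![1, 0, 1] v) (P ![1, 0, 0] v) (by simp [hPa]) (by simp [hPb]) (by simp [hPc, hv]),
      hext (P ![0, 0, 1] v) 0 (by simp [hPa]) (by simp [hPb])
        (by simp [hPc, hv]), hz h₀, h02 (P ![0, 1, 0] v) (by simp [hPa]) (by simp [hPc])]
    ring

/-- A quadratic form vanishing at three points of a line vanishes on the line. -/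
theorem vanish_of_three_points {l a b c : Fin 3 → ℂ} (hab : det3 l a b ≠ 0) (hac : det3 l a c ≠ 0)
    (hbc : det3 l b c ≠ 0) (hf : IsForm 2 f)
    (ha : ∀ v, apply3 l v = 0 → apply3 a v = 0 → f v = 0)
    (hb : ∀ v, apply3 l v = 0 → apply3 b v = 0 → f v = 0)
    (hc : ∀ v, apply3 l v = 0 → apply3 c v = 0 → f v = 0) :
    ∀ v, apply3 l v = 0 → f v = 0 := by
  obtain ⟨T, S, hT, hS, hTS⟩ := exists_frame hab
  obtain ⟨k, hk⟩ := (hf.comp T).exists_coeff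
  simp [Finset.sum_range_succ] at hk
  have h1 := hk ![0, 1, 0]
  have h2 := hk ![0, 0, 1]
  rw [hb _ (by simp [hT]) (by simp [hT])] at h1
  rw [ha _ (by simp [hT]) (by simp [hT])] at h2
  simp at h1 h2
  set β := apply3 c (T ![0, 1, 0])
  set γ := apply3 c (T ![0, 0, 1])
  have hne : ∀ i : Fin 3, T (Pi.single i 1) ≠ 0 := by
    intro i h0
    have := hT (Pi.single i 1)
    rw [h0] at this
    fin_cases i <;> simp [apply3] at this
  have e1 : (![0, 1, 0] : Fin 3 → ℂ) = Pi.single 1 1 := by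
    ext i; fin_cases i <;> simp
  have e2 : (![0, 0, 1] : Fin 3 → ℂ) = Pi.single 2 1 := by
    ext i; fin_cases i <;> simp
  have hβ : β ≠ 0 := fun h0 => hne 1 <| e1 ▸ eq_zero_of_det3_ne_zero hbc (by simp [hT])
    (by simp [hT]) h0
  have hγ : γ ≠ 0 := fun h0 => hne 2 <| e2 ▸ eq_zero_of_det3_ne_zero hac (by simp [hT])
    (by simp [hT]) h0
  have hlin : apply3 c (T ![0, γ, -β]) = 0 := by
    have : (![0, γ, -β] : Fin 3 → ℂ) = γ • ![0, 1, 0] - β • ![0, 0, 1] := by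
      ext i; fin_cases i <;> simp
    have h3 : ∀ u v : Fin 3 → ℂ, apply3 c (γ • u - β • v) = γ * apply3 c u - β * apply3 c v := by
      intro u v; simp [apply3]; ring
    rw [this, map_sub, map_smul, map_smul, h3]
    change γ * β - β * γ = 0
    ring
  have h3 := hk ![0, γ, -β]
  rw [hc _ (by simp [hT]) hlin] at h3
  have h01 : k 0 1 = 0 := by
    simpa [← h1, ← h2, hβ, hγ] using h3
  intro v hv
  have := hk (S v)
  rw [hTS] at this
  rw [this]
  simp [hS, hv, ← h1, ← h2, h01]

end IsForm

/-- No three lines of the family are concurrent. -/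
def NoConc {ι : Type*} (L : ι → Fin 3 → ℂ) : Prop :=
  ∀ i j k, i ≠ j → i ≠ k → j ≠ k → det3 (L i) (L j) (L k) ≠ 0

theorem NoConc.comp {ι κ : Type*} {L : ι → Fin 3 → ℂ} (h : NoConc L) {g : κ → ι}
    (hg : Function.Injective g) : NoConc (L ∘ g) :=
  fun _ _ _ hij hik hjk => h _ _ _ (hg.ne hij) (hg.ne hik) (hg.ne hjk)

/-- Quadratic forms on pairwise transversal lines which agree at the intersection points are the
restrictions of one quadratic form. -/
theorem exists_common_quadric {ι : Type*} {L : ι → Fin 3 → ℂ} (hL : NoConc L)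
    {q : ι → (Fin 3 → ℂ) → ℂ} (hq : ∀ i, IsForm 2 (q i))
    (hc : ∀ i j, i ≠ j → ∀ v, apply3 (L i) v = 0 → apply3 (L j) v = 0 → q i v = q j v)
    {a b c : ι} (hab : a ≠ b) (hac : a ≠ c) (hbc : b ≠ c) :
    ∃ Q, IsForm 2 Q ∧ ∀ i v, apply3 (L i) v = 0 → Q v = q i v := by
  obtain ⟨Q, hQ, ha, hb, hc'⟩ := IsForm.exists_interpolation (hL a b c hab hac hbc) (hq a) (hq b)
    (hq c) (hc a b hab) (hc a c hac) (hc b c hbc)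
  refine ⟨Q, hQ, fun i v hv => ?_⟩
  by_cases h1 : i = a
  · exact h1 ▸ ha v (h1 ▸ hv)
  by_cases h2 : i = b
  · exact h2 ▸ hb v (h2 ▸ hv)
  by_cases h3 : i = c
  · exact h3 ▸ hc' v (h3 ▸ hv)
  refine sub_eq_zero.1 (IsForm.vanish_of_three_points (hL i a b h1 h2 hab) (hL i a c h1 h3 hac)
    (hL i b c h2 h3 hbc) (hQ.sub (hq i)) (fun v hi h => ?_) (fun v hi h => ?_) (fun v hi h => ?_)
    v hv)
  · simp [ha v h, hc i a h1 v hi h]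
  · simp [hb v h, hc i b h2 v hi h]
  · simp [hc' v h, hc i c h3 v hi h]

theorem exists_eq_four_lines {L : Fin 4 → Fin 3 → ℂ} (hL : NoConc L) {f : (Fin 3 → ℂ) → ℂ}
    (hf : IsForm 4 f) (h : ∀ i v, apply3 (L i) v = 0 → f v = 0) :
    ∃ κ : ℂ, ∀ v, f v = κ * (apply3 (L 0) v * apply3 (L 1) v *
      (apply3 (L 2) v * apply3 (L 3) v)) := by
  have hd := fun i j k hij hik hjk => hL i j k hij hik hjk
  obtain ⟨g₀, hg₀, e₀⟩ := hf.exists_eq_line_mul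
    (hd 0 1 2 (by decide) (by decide) (by decide)) (h 0)
  have h₀ : ∀ i, i ≠ 0 → ∀ v, apply3 (L i) v = 0 → g₀ v = 0 := fun i hi => by
    obtain ⟨k, hk, hk'⟩ : ∃ k : Fin 4, k ≠ 0 ∧ k ≠ i := by revert hi; revert i; decide
    exact hg₀.vanish_of_mul (hd 0 i k hi.symm hk.symm hk'.symm)
      fun v hv => by rw [← e₀, h i v hv]
  obtain ⟨g₁, hg₁, e₁⟩ := hg₀.exists_eq_line_mul
    (hd 1 2 3 (by decide) (by decide) (by decide)) (h₀ 1 (by decide))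
  have h₁ : ∀ i, i ≠ 0 → i ≠ 1 → ∀ v, apply3 (L i) v = 0 → g₁ v = 0 := fun i hi hi1 =>
    hg₁.vanish_of_mul (hd 1 i 0 hi1.symm (by decide) hi)
      fun v hv => by rw [← e₁, h₀ i hi v hv]
  obtain ⟨g₂, hg₂, e₂⟩ := hg₁.exists_eq_line_mul
    (hd 2 1 3 (by decide) (by decide) (by decide)) (h₁ 2 (by decide) (by decide))
  have h₂ : ∀ v, apply3 (L 3) v = 0 → g₂ v = 0 :=
    hg₂.vanish_of_mul (hd 2 3 0 (by decide) (by decide) (by decide))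
      fun v hv => by rw [← e₂, h₁ 3 (by decide) (by decide) v hv]
  obtain ⟨g₃, hg₃, e₃⟩ := hg₂.exists_eq_line_mul
    (hd 3 1 2 (by decide) (by decide) (by decide)) h₂
  obtain ⟨κ, hκ⟩ := hg₃.of_deg_zero
  exact ⟨κ, fun v => by rw [e₀, e₁, e₂, e₃, hκ]; ring⟩

theorem eq_zero_of_vanish_five {L : Fin 5 → Fin 3 → ℂ} (hL : NoConc L) {f : (Fin 3 → ℂ) → ℂ}
    (hf : IsForm 4 f) (h : ∀ i v, apply3 (L i) v = 0 → f v = 0) (v) : f v = 0 := by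
  obtain ⟨κ, hκ⟩ := exists_eq_four_lines (hL.comp (Fin.castSucc_injective 4)) hf
    fun i v hv => h _ v hv
  have hd := fun i j k hij hik hjk => hL i j k hij hik hjk
  by_cases hk : κ = 0
  · simp [hκ, hk]
  have key : ∀ v, apply3 (L 4) v = 0 → apply3 (L 0) v * (apply3 (L 1) v *
      (apply3 (L 2) v * apply3 (L 3) v)) = 0 := by
    intro v hv
    have := hκ v
    rw [h 4 v hv] at this
    have := (mul_eq_zero.1 this.symm).resolve_left hk
    rw [← this]
    simp only [Function.comp_apply]
    change _ = apply3 (L 0) v * apply3 (L 1) v * (apply3 (L 2) v * apply3 (L 3) v)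
    ring
  have F := fun i => isForm_apply3 (L i)
  have k1 := IsForm.vanish_of_mul (hd 0 4 1 (by decide) (by decide) (by decide))
    ((F 1).mul ((F 2).mul (F 3))) key
  have k2 := IsForm.vanish_of_mul (hd 1 4 0 (by decide) (by decide) (by decide))
    ((F 2).mul (F 3)) k1
  have k3 := IsForm.vanish_of_mul (hd 2 4 0 (by decide) (by decide) (by decide)) (F 3) k2
  obtain ⟨T, S, hT, -, -⟩ := exists_frame (hd 4 3 0 (by decide) (by decide) (by decide))
  have := k3 (T ![0, 1, 0]) (by simp [hT])
  simp [hT] at this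

/-- A quartic form restricting to compatible squares on five lines is a square. -/
theorem eq_sq_of_five {L : Fin 5 → Fin 3 → ℂ} (hL : NoConc L) {f : (Fin 3 → ℂ) → ℂ}
    (hf : IsForm 4 f) {q : Fin 5 → (Fin 3 → ℂ) → ℂ} (hq : ∀ i, IsForm 2 (q i))
    (hc : ∀ i j, i ≠ j → ∀ v, apply3 (L i) v = 0 → apply3 (L j) v = 0 → q i v = q j v)
    (hs : ∀ i v, apply3 (L i) v = 0 → f v = q i v ^ 2) :
    ∃ Q, IsForm 2 Q ∧ ∀ v, f v = Q v ^ 2 := by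
  obtain ⟨Q, hQ, h⟩ := exists_common_quadric hL hq hc (a := 0) (b := 1) (c := 2) (by decide)
    (by decide) (by decide)
  refine ⟨Q, hQ, fun v => sub_eq_zero.1 (eq_zero_of_vanish_five hL (hf.sub hQ.sq)
    (fun i v hv => ?_) v)⟩
  rw [hs i v hv, h i v hv, sub_self]

theorem exists_four {L : Fin 4 → Fin 3 → ℂ} (hL : NoConc L) {f : (Fin 3 → ℂ) → ℂ}
    (hf : IsForm 4 f) {q : Fin 4 → (Fin 3 → ℂ) → ℂ} (hq : ∀ i, IsForm 2 (q i))
    (hc : ∀ i j, i ≠ j → ∀ v, apply3 (L i) v = 0 → apply3 (L j) v = 0 → q i v = q j v)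
    (hs : ∀ i v, apply3 (L i) v = 0 → f v = q i v ^ 2) :
    ∃ Q κ, IsForm 2 Q ∧ (∀ i v, apply3 (L i) v = 0 → Q v = q i v) ∧
      ∀ v, f v = Q v ^ 2 + κ * (apply3 (L 0) v * apply3 (L 1) v *
        (apply3 (L 2) v * apply3 (L 3) v)) := by
  obtain ⟨Q, hQ, h⟩ := exists_common_quadric hL hq hc (a := 0) (b := 1) (c := 2) (by decide)
    (by decide) (by decide)
  obtain ⟨κ, hκ⟩ := exists_eq_four_lines hL (hf.sub hQ.sq) fun i v hv => by
    rw [hs i v hv, h i v hv, sub_self]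
  exact ⟨Q, κ, hQ, h, fun v => by rw [← hκ]; ring⟩

/-- Three syzygetic completions of a compatible pair of lines produce a linear relation. -/
theorem false_of_three_completions {a b : Fin 3 → ℂ} {r : Fin 3 → Fin 2 → Fin 3 → ℂ}
    {f : (Fin 3 → ℂ) → ℂ} (hf : IsForm 4 f) (hns : ¬ ∃ Q, IsForm 2 Q ∧ ∀ v, f v = Q v ^ 2)
    (hL : ∀ i, NoConc ![a, b, r i 0, r i 1])
    {q₀ q₁ : (Fin 3 → ℂ) → ℂ} {p : Fin 3 → Fin 2 → (Fin 3 → ℂ) → ℂ}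
    (hq₀ : IsForm 2 q₀) (hq₁ : IsForm 2 q₁) (hp : ∀ i k, IsForm 2 (p i k))
    (hab : ∀ v, apply3 a v = 0 → apply3 b v = 0 → q₀ v = q₁ v)
    (har : ∀ i k v, apply3 a v = 0 → apply3 (r i k) v = 0 → q₀ v = p i k v)
    (hbr : ∀ i k v, apply3 b v = 0 → apply3 (r i k) v = 0 → q₁ v = p i k v)
    (hrr : ∀ i v, apply3 (r i 0) v = 0 → apply3 (r i 1) v = 0 → p i 0 v = p i 1 v)
    (hsa : ∀ v, apply3 a v = 0 → f v = q₀ v ^ 2) (hsb : ∀ v, apply3 b v = 0 → f v = q₁ v ^ 2)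
    (hsr : ∀ i k v, apply3 (r i k) v = 0 → f v = p i k v ^ 2)
    (hI : ∀ k₀ k₁ k₂ k₃ : ℂ, (∀ v, k₀ * (apply3 a v * apply3 b v)
      + k₁ * (apply3 (r 0 0) v * apply3 (r 0 1) v) + k₂ * (apply3 (r 1 0) v * apply3 (r 1 1) v)
      + k₃ * (apply3 (r 2 0) v * apply3 (r 2 1) v) = 0) → k₁ = 0 ∧ k₂ = 0 ∧ k₃ = 0) : False := by
  have main : ∀ i, ∃ Q κ, IsForm 2 Q ∧ (∀ v, apply3 a v = 0 → Q v = q₀ v) ∧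
      (∀ v, apply3 b v = 0 → Q v = q₁ v) ∧
      ∀ v, f v = Q v ^ 2 + κ * (apply3 a v * apply3 b v *
        (apply3 (r i 0) v * apply3 (r i 1) v)) := by
    intro i
    obtain ⟨Q, κ, hQ, h, hκ⟩ := exists_four (hL i) hf (q := ![q₀, q₁, p i 0, p i 1])
      (fun j => by fin_cases j <;> simp [hq₀, hq₁, hp])
      (fun j k hjk v hj hk => by
        fin_cases j <;> fin_cases k <;> simp at hjk hj hk ⊢
        · exact hab v hj hk
        · exact har i 0 v hj hk
        · exact har i 1 v hj hk
        · exact (hab v hk hj).symm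
        · exact hbr i 0 v hj hk
        · exact hbr i 1 v hj hk
        · exact (har i 0 v hk hj).symm
        · exact (hbr i 0 v hk hj).symm
        · exact hrr i v hj hk
        · exact (har i 1 v hk hj).symm
        · exact (hbr i 1 v hk hj).symm
        · exact (hrr i v hk hj).symm)
      (fun j v hj => by
        fin_cases j <;> simp at hj ⊢
        · exact hsa v hj
        · exact hsb v hj
        · exact hsr i 0 v hj
        · exact hsr i 1 v hj)
    exact ⟨Q, κ, hQ, h 0, h 1, hκ⟩
  choose Q κ hQ hQa hQb hfQ using main
  have hκ : ∀ i, κ i ≠ 0 := fun i h0 => hns ⟨Q i, hQ i, fun v => by simp [hfQ i, h0]⟩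
  have hdet : det3 a b (r 0 0) ≠ 0 := hL 0 0 1 2 (by decide) (by decide) (by decide)
  have hdet' : det3 b a (r 0 0) ≠ 0 := hL 0 1 0 2 (by decide) (by decide) (by decide)
  have hlam : ∀ i, ∃ l : ℂ, ∀ v, Q i v = Q 0 v + l * (apply3 a v * apply3 b v) := by
    intro i
    obtain ⟨g, hg, e⟩ := ((hQ i).sub (hQ 0)).exists_eq_line_mul hdet
      fun v hv => by simp [hQa _ v hv]
    obtain ⟨g', hg', e'⟩ := hg.exists_eq_line_mul hdet' <|
      hg.vanish_of_mul hdet fun v hv => by simp [← e, hQb _ v hv]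
    obtain ⟨l, hl⟩ := hg'.of_deg_zero
    refine ⟨l, fun v => ?_⟩
    have := e v
    rw [e', hl] at this
    linear_combination this
  choose l hl using hlam
  set P : (Fin 3 → ℂ) → ℂ := fun v => apply3 a v * apply3 b v
  set R : Fin 3 → (Fin 3 → ℂ) → ℂ := fun i v => apply3 (r i 0) v * apply3 (r i 1) v
  have hP : IsForm 2 P := (isForm_apply3 a).mul (isForm_apply3 b)
  have hR : ∀ i, IsForm 2 (R i) := fun i => (isForm_apply3 _).mul (isForm_apply3 _)
  have hP0 : ¬ ∀ v, P v = 0 := by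
    obtain ⟨T, S, hT, -, -⟩ := exists_frame hdet
    intro h
    have := h (T ![1, 1, 0])
    simp [P, hT] at this
  have hE : ∀ i v, κ 0 * R 0 v - κ i * R i v - (2 * l i) * Q 0 v - l i ^ 2 * P v = 0 := by
    intro i
    refine (IsForm.eq_zero_or_eq_zero hP (((((hR 0).const_mul (κ 0)).sub
      ((hR i).const_mul (κ i))).sub ((hQ 0).const_mul (2 * l i))).sub
      (hP.const_mul (l i ^ 2))) fun v => ?_).resolve_left hP0
    have e1 := (hfQ 0 v).symm.trans (hfQ i v)
    rw [hl i v] at e1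
    linear_combination e1
  by_cases h1 : l 1 = 0
  · have := hI 0 (κ 0) (-κ 1) 0 fun v => by
      have := hE 1 v
      rw [h1] at this
      linear_combination this
    exact hκ 0 this.1
  · have := hI (l 1 ^ 2 * (-l 2) + l 2 ^ 2 * l 1) (l 2 * κ 0 - l 1 * κ 0) (-l 2 * κ 1) (l 1 * κ 2)
      fun v => by linear_combination l 2 * hE 1 v - l 1 * hE 2 v
    exact hκ 2 ((mul_eq_zero.1 this.2.2).resolve_left h1)

/-- The common point of two lines. -/
def cross3 {R : Type*} [CommRing R] (l m : Fin 3 → R) : Fin 3 → R :=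
  ![l 1 * m 2 - l 2 * m 1, l 2 * m 0 - l 0 * m 2, l 0 * m 1 - l 1 * m 0]

/-- A quadratic form in the first two coordinates. -/
def quad (q v : Fin 3 → ℂ) : ℂ := q 0 * v 0 ^ 2 + q 1 * (v 0 * v 1) + q 2 * v 1 ^ 2

theorem isForm_quad (q : Fin 3 → ℂ) : IsForm 2 (quad q) := by
  have h0 := IsForm.coord 0
  have h1 := IsForm.coord 1
  have := ((h0.sq.const_mul (q 0)).add ((h0.mul h1).const_mul (q 1))).add (h1.sq.const_mul (q 2))
  exact this

theorem quad_smul_left (c : ℂ) (q v : Fin 3 → ℂ) : quad (c • q) v = c * quad q v := by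
  simp [quad]; ring

theorem quad_sub_left (q q' v : Fin 3 → ℂ) : quad (q - q') v = quad q v - quad q' v := by
  simp [quad]; ring

theorem apply3_cross3 (l m : Fin 3 → ℂ) : apply3 l (cross3 l m) = 0 ∧ apply3 m (cross3 l m) = 0 := by
  constructor <;> simp [apply3, cross3] <;> ring

theorem exists_eq_smul_cross3 {l m n v : Fin 3 → ℂ} (h : det3 l m n ≠ 0) (hl : apply3 l v = 0)
    (hm : apply3 m v = 0) : ∃ t : ℂ, v = t • cross3 l m := by
  refine ⟨apply3 n v / det3 l m n, ?_⟩
  have hsub : ∀ a u w : Fin 3 → ℂ, apply3 a (u - w) = apply3 a u - apply3 a w := by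
    intro a u w; simp [apply3]; ring
  have hn : apply3 n (cross3 l m) = det3 l m n := by
    simp [apply3, cross3, det3]; ring
  refine sub_eq_zero.1 (eq_zero_of_det3_ne_zero h ?_ ?_ ?_)
  · rw [hsub, apply3_smul, hl, (apply3_cross3 l m).1]; ring
  · rw [hsub, apply3_smul, hm, (apply3_cross3 l m).2]; ring
  · rw [hsub, apply3_smul, hn]; field_simp; ring

/-- Signs as complex numbers. -/
abbrev sgn (u : ℤˣ) : ℂ := ((u : ℤ) : ℂ)

theorem sgn_mul (u v : ℤˣ) : sgn (u * v) = sgn u * sgn v := by simp [sgn]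

theorem sgn_mul_self (u : ℤˣ) : sgn u * sgn u = 1 := by
  rw [← sgn_mul, Int.units_mul_self]; simp [sgn]

abbrev EdgeAt (a : Fin 7) (e : Edge) : Prop := e.1.1 = a ∨ e.1.2 = a

/-- Some star has signs of the form `c e * c f`. -/
def StarTrivial (ε : Edge → Edge → ℤˣ) : Prop :=
  ∃ (a : Fin 7) (c : Edge → ℤˣ), ∀ e f, e ≠ f → EdgeAt a e → EdgeAt a f → ε e f = c e * c f

def DisjTrivial (ε : Edge → Edge → ℤˣ) : Prop :=
  ∃ c : Edge → ℤˣ, ∀ e f, EdgeDisj e f → ε e f = c e * c f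

/-- Quadratic forms on the lines agreeing at intersections up to the signs `ε`. -/
def SignKer (L : Edge → Fin 3 → ℂ) (ε : Edge → Edge → ℤˣ) (q : Edge → Fin 3 → ℂ) : Prop :=
  ∀ e f, e ≠ f → quad (q e) (cross3 (L e) (L f)) = sgn (ε e f) * quad (q f) (cross3 (L e) (L f))

/-- The sign pattern of the tangency conics. -/
def thetaSign (e f : Edge) : ℤˣ := if EdgeDisj e f then 1 else -1

abbrev edge01 : Edge := ⟨(0, 1), by decide⟩

/-- The genericity properties of the lines used in the reconstruction. -/
structure GoodLines (L : Edge → Fin 3 → ℂ) : Prop where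
  noConc : NoConc L
  indep : ∀ e f, e ≠ f → ¬ EdgeDisj e f → ∀ k₀ k₁ k₂ k₃ : ℂ, (∀ v, k₀ * (apply3 (L e) v * apply3 (L f) v)
      + k₁ * (apply3 (L (restEdges e f 0 0)) v * apply3 (L (restEdges e f 0 1)) v)
      + k₂ * (apply3 (L (restEdges e f 1 0)) v * apply3 (L (restEdges e f 1 1)) v)
      + k₃ * (apply3 (L (restEdges e f 2 0)) v * apply3 (L (restEdges e f 2 1)) v) = 0) →
      k₁ = 0 ∧ k₂ = 0 ∧ k₃ = 0
  sign : ∀ ε, ¬ StarTrivial ε → ¬ DisjTrivial ε → ∀ q, SignKer L ε q → q = 0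
  theta : ∀ q, SignKer L thetaSign q → q edge01 2 = 0 → q = 0

def SquareOn (L : Edge → Fin 3 → ℂ) (f : (Fin 3 → ℂ) → ℂ) (q : Edge → Fin 3 → ℂ) : Prop :=
  ∀ e v, apply3 (L e) v = 0 → f v = quad (q e) v ^ 2

/-- Five edges at the vertex `a`. -/
def starEdge (a : Fin 7) (i : Fin 5) : Edge := mkEdge a (a + ⟨i + 1, by omega⟩)

theorem starEdge_injective : ∀ a, Function.Injective (starEdge a) := by
  unfold Function.Injective; decide +kernel

theorem edgeAt_starEdge : ∀ a i, EdgeAt a (starEdge a i) := by decide +kernel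

theorem EdgeDisj.ne {e f : Edge} (h : EdgeDisj e f) : e ≠ f := fun h' => h.1 (h' ▸ rfl)

theorem restEdges_injective : ∀ e f : Edge, e ≠ f → ¬ EdgeDisj e f → ∀ i,
    Function.Injective ![e, f, restEdges e f i 0, restEdges e f i 1] := by
  unfold Function.Injective; decide +kernel

namespace GoodLines

variable {L : Edge → Fin 3 → ℂ}

theorem exists_third (e f : Edge) (h : e ≠ f) : ∃ g : Edge, e ≠ g ∧ f ≠ g := by
  revert h; revert e f; decide +kernel

theorem quad_eq_of_cross (hL : GoodLines L) {e f : Edge} (hef : e ≠ f) {c : ℂ} {q q' : Fin 3 → ℂ}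
    (h : quad q (cross3 (L e) (L f)) = c * quad q' (cross3 (L e) (L f))) (v : Fin 3 → ℂ)
    (he : apply3 (L e) v = 0) (hf : apply3 (L f) v = 0) : quad q v = c * quad q' v := by
  obtain ⟨g, heg, hfg⟩ := exists_third e f hef
  obtain ⟨t, rfl⟩ := exists_eq_smul_cross3 (hL.noConc e f g hef heg hfg) he hf
  rw [(isForm_quad q).smul, (isForm_quad q').smul, h]
  ring

theorem exists_theta (hL : GoodLines L) {f : (Fin 3 → ℂ) → ℂ} (hf : IsForm 4 f)
    (hns : ¬ ∃ Q, IsForm 2 Q ∧ ∀ v, f v = Q v ^ 2) {q : Edge → Fin 3 → ℂ}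
    (hq : SquareOn L f q) : ∃ q', SquareOn L f q' ∧ SignKer L thetaSign q' := by
  classical
  set ε : Edge → Edge → ℤˣ := fun e g =>
    if quad (q e) (cross3 (L e) (L g)) = quad (q g) (cross3 (L e) (L g)) then 1 else -1 with hε
  have hker : SignKer L ε q := by
    intro e g _
    simp only [ε]
    split_ifs with h
    · simpa [sgn] using h
    · have h1 := (hq e _ (apply3_cross3 (L e) (L g)).1).symm.trans
        (hq g _ (apply3_cross3 (L e) (L g)).2)
      simpa [sgn] using (sq_eq_sq_iff_eq_or_eq_neg.1 h1).resolve_left h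
  have hsw : ∀ c : Edge → ℤˣ, SquareOn L f fun e => sgn (c e) • q e := by
    intro c e v hv
    rw [hq e v hv, quad_smul_left, mul_pow, pow_two (sgn _), sgn_mul_self, one_mul]
  have hagree : ∀ c : Edge → ℤˣ, ∀ e g, e ≠ g → ε e g = c e * c g → ∀ v, apply3 (L e) v = 0 →
      apply3 (L g) v = 0 → quad (sgn (c e) • q e) v = quad (sgn (c g) • q g) v := by
    intro c e g heg h v he hg
    rw [quad_smul_left, quad_smul_left, hL.quad_eq_of_cross heg (hker e g heg) v he hg, h, sgn_mul]
    linear_combination (sgn (c g) * quad (q g) v) * sgn_mul_self (c e)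
  have hstar : ¬ StarTrivial ε := by
    rintro ⟨a, c, h⟩
    refine hns (eq_sq_of_five (hL.noConc.comp (starEdge_injective a)) hf
      (q := fun i => quad (sgn (c (starEdge a i)) • q (starEdge a i)))
      (fun i => isForm_quad _) (fun i j hij v hi hj => ?_) (fun i v hv => hsw c _ v hv))
    have hne := (starEdge_injective a).ne hij
    exact hagree c _ _ hne (h _ _ hne (edgeAt_starEdge a i) (edgeAt_starEdge a j)) v hi hj
  have hdisj : DisjTrivial ε := by
    by_contra h
    have h0 : q = 0 := hL.sign ε hstar h q hker
    refine hns ⟨fun _ => 0, IsForm.zero 2, fun v => ?_⟩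
    rw [eq_zero_of_vanish_five (hL.noConc.comp (starEdge_injective 0)) hf (fun i v hv => ?_) v]
    · simp
    · rw [hq _ v hv, h0]; simp [quad]
  obtain ⟨c, hc⟩ := hdisj
  set q' : Edge → Fin 3 → ℂ := fun e => sgn (c e) • q e
  have hd : ∀ e g, EdgeDisj e g → ∀ v, apply3 (L e) v = 0 → apply3 (L g) v = 0 →
      quad (q' e) v = quad (q' g) v := fun e g h => hagree c e g h.ne (hc e g h)
  refine ⟨q', hsw c, fun e g heg => ?_⟩
  have hx := apply3_cross3 (L e) (L g)
  by_cases h : EdgeDisj e g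
  · rw [show thetaSign e g = 1 from if_pos h]
    simpa [sgn] using hd e g h _ hx.1 hx.2
  · rcases sq_eq_sq_iff_eq_or_eq_neg.1 ((hsw c e _ hx.1).symm.trans (hsw c g _ hx.2)) with h1 | h1
    · exfalso
      have hr := restEdges_spec e g heg h
      have h1' : quad (q' e) (cross3 (L e) (L g)) = 1 * quad (q' g) (cross3 (L e) (L g)) := by
        simpa using h1
      refine false_of_three_completions (a := L e) (b := L g) (r := fun i k => L (restEdges e g i k))
        hf hns (fun i => ?_) (isForm_quad (q' e)) (isForm_quad (q' g))
        (p := fun i k => quad (q' (restEdges e g i k))) (fun i k => isForm_quad _)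
        (fun v he hg => by simpa using hL.quad_eq_of_cross heg h1' v he hg)
        (fun i k => hd _ _ ((hr i).2 k).1) (fun i k => hd _ _ ((hr i).2 k).2)
        (fun i => hd _ _ (hr i).1) (hsw c e) (hsw c g) (fun i k => hsw c _)
        (hL.indep e g heg h)
      convert hL.noConc.comp (restEdges_injective e g heg h i) using 1
      funext j
      fin_cases j <;> rfl
    · rw [show thetaSign e g = -1 from if_neg h]
      simpa [sgn] using h1

/-- Two quartics which are squares on the same good lines are proportional. -/
theorem proportional (hL : GoodLines L) {f g : (Fin 3 → ℂ) → ℂ} (hf : IsForm 4 f)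
    (hg : IsForm 4 g) (hnf : ¬ ∃ Q, IsForm 2 Q ∧ ∀ v, f v = Q v ^ 2)
    (hng : ¬ ∃ Q, IsForm 2 Q ∧ ∀ v, g v = Q v ^ 2) {q r : Edge → Fin 3 → ℂ}
    (hq : SquareOn L f q) (hr : SquareOn L g r) : ∃ c : ℂ, c ≠ 0 ∧ ∀ v, g v = c * f v := by
  obtain ⟨q, hq, hkq⟩ := hL.exists_theta hf hnf hq
  obtain ⟨r, hr, hkr⟩ := hL.exists_theta hg hng hr
  have hne : ∀ {h : (Fin 3 → ℂ) → ℂ} {s : Edge → Fin 3 → ℂ}, IsForm 4 h →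
      (¬ ∃ Q, IsForm 2 Q ∧ ∀ v, h v = Q v ^ 2) → SquareOn L h s → SignKer L thetaSign s →
      s edge01 2 ≠ 0 := by
    intro h s hh hn hs hk h0
    have hs0 := hL.theta s hk h0
    refine hn ⟨fun _ => 0, IsForm.zero 2, fun v => ?_⟩
    rw [eq_zero_of_vanish_five (hL.noConc.comp (starEdge_injective 0)) hh (fun i v hv => ?_) v]
    · simp
    · rw [hs _ v hv, hs0]; simp [quad]
  have h1 := hne hf hnf hq hkq
  have h2 := hne hg hng hr hkr
  set c := r edge01 2 / q edge01 2 with hc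
  have hrc : r - c • q = 0 := by
    refine hL.theta _ (fun e g heg => ?_) ?_
    · have e1 := hkq e g heg
      have e2 := hkr e g heg
      simp only [Pi.sub_apply, Pi.smul_apply, quad_sub_left, quad_smul_left, e1, e2]
      ring
    · simp [c, h1]
  have hrc := sub_eq_zero.1 hrc
  refine ⟨c ^ 2, by simp [c, h1, h2], fun v => sub_eq_zero.1 ?_⟩
  refine eq_zero_of_vanish_five (hL.noConc.comp (starEdge_injective 0))
    (hg.sub (hf.const_mul (c ^ 2))) (fun i v hv => ?_) v
  rw [hq _ v hv, hr _ v hv, hrc]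
  simp only [Pi.smul_apply, quad_smul_left]
  ring

end GoodLines

/-- A property holding outside a proper hypersurface of the parameter space. -/
def Generic (p : (Fin 18 → ℂ) → Prop) : Prop :=
  ∃ h : MvPolynomial (Fin 18) ℂ, h ≠ 0 ∧ ∀ θ, eval θ h ≠ 0 → p θ

namespace Generic

variable {p q : (Fin 18 → ℂ) → Prop}

theorem mono (hp : Generic p) (h : ∀ θ, p θ → q θ) : Generic q := by
  obtain ⟨f, hf, hfp⟩ := hp
  exact ⟨f, hf, fun θ hθ => h θ (hfp θ hθ)⟩

theorem and (hp : Generic p) (hq : Generic q) : Generic fun θ => p θ ∧ q θ := by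
  obtain ⟨f, hf, hfp⟩ := hp
  obtain ⟨g, hg, hgq⟩ := hq
  refine ⟨f * g, mul_ne_zero hf hg, fun θ hθ => ?_⟩
  rw [map_mul] at hθ
  exact ⟨hfp θ (left_ne_zero_of_mul hθ), hgq θ (right_ne_zero_of_mul hθ)⟩

theorem all {ι : Type*} [Finite ι] {r : ι → (Fin 18 → ℂ) → Prop} (h : ∀ i, Generic (r i)) :
    Generic fun θ => ∀ i, r i θ := by
  have := Fintype.ofFinite ι
  choose f hf hfr using h
  refine ⟨∏ i, f i, Finset.prod_ne_zero_iff.2 fun i _ => hf i, fun θ hθ i => hfr i θ ?_⟩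
  rw [map_prod] at hθ
  exact Finset.prod_ne_zero_iff.1 hθ i (Finset.mem_univ i)

theorem imp {r : Prop} (h : r → Generic p) : Generic fun θ => r → p θ := by
  by_cases hr : r
  · exact (h hr).mono fun _ hp _ => hp
  · exact ⟨1, one_ne_zero, fun _ _ h => (hr h).elim⟩

theorem of_eval (h : MvPolynomial (Fin 18) ℂ) {θ₀ : Fin 18 → ℂ} (h₀ : eval θ₀ h ≠ 0) :
    Generic fun θ => eval θ h ≠ 0 :=
  ⟨h, fun h' => h₀ (by simp [h']), fun _ => id⟩

/-- Injectivity of a matrix depending polynomially on parameters is an open condition. -/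
theorem injective_mulVec {ι κ : Type*} [Fintype ι] [Fintype κ]
    (M : Matrix ι κ (MvPolynomial (Fin 18) ℂ)) {θ₀ : Fin 18 → ℂ}
    (h₀ : ∀ x, (M.map (eval θ₀)).mulVec x = 0 → x = 0) :
    Generic fun θ => ∀ x, (M.map (eval θ)).mulVec x = 0 → x = 0 := by
  classical
  obtain ⟨g, hg⟩ := LinearMap.exists_leftInverse_of_injective (M.map (eval θ₀)).mulVecLin
    (LinearMap.ker_eq_bot'.2 h₀)
  set N : Matrix κ ι ℂ := LinearMap.toMatrix' g
  set N' : Matrix κ ι (MvPolynomial (Fin 18) ℂ) := N.map C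
  have hN : N * M.map (eval θ₀) = 1 := by
    have := congrArg LinearMap.toMatrix' hg
    rwa [LinearMap.toMatrix'_comp, ← Matrix.toLin'_apply', LinearMap.toMatrix'_toLin',
      LinearMap.toMatrix'_id] at this
  have hmap : ∀ θ : Fin 18 → ℂ, eval θ (N' * M).det = (N * M.map (eval θ)).det := by
    intro θ
    rw [RingHom.map_det]
    congr 1
    rw [RingHom.mapMatrix_apply, Matrix.map_mul]
    congr 1
    ext i j
    simp [N']
  refine (of_eval (N' * M).det (θ₀ := θ₀) ?_).mono fun θ hθ x hx => ?_
  · rw [hmap, hN, Matrix.det_one]; exact one_ne_zero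
  · rw [hmap] at hθ
    refine Matrix.eq_zero_of_mulVec_eq_zero hθ ?_
    rw [← Matrix.mulVec_mulVec, hx, Matrix.mulVec_zero]

end Generic

/-- An integral parameter as a complex parameter. -/
abbrev castParam (θ : Fin 18 → ℤ) : Fin 18 → ℂ := Int.castRingHom ℂ ∘ θ

theorem eval_comp_X (θ : Fin 18 → ℂ) : (eval θ) ∘ (X : Fin 18 → MvPolynomial (Fin 18) ℂ) = θ := by
  funext i; simp

theorem eval_edgeCov (θ : Fin 18 → ℂ) (e : Edge) :
    (eval θ : MvPolynomial (Fin 18) ℂ →+* ℂ) ∘ edgeCov X e = edgeCov θ e := by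
  funext m
  rw [Function.comp_apply, edgeCov, ← map_lineCov, eval_comp_X]

theorem castParam_edgeCov (θ : Fin 18 → ℤ) (e : Edge) (m : Fin 3) :
    edgeCov (castParam θ) e m = ((edgeCov θ e m : ℤ) : ℂ) :=
  map_lineCov (Int.castRingHom ℂ) θ _ _ m

theorem castParam_edgeCov' (θ : Fin 18 → ℤ) (e : Edge) :
    edgeCov (castParam θ) e = Int.castRingHom ℂ ∘ edgeCov θ e :=
  _root_.funext fun m => castParam_edgeCov θ e m

theorem generic_edgeCov_ne_zero : Generic fun θ => ∀ e, edgeCov θ e 2 ≠ 0 := by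
  refine .all fun e => (Generic.of_eval (edgeCov X e 2) (θ₀ := castParam genericParam) ?_).mono
    fun θ hθ => ?_
  · have := congrFun (eval_edgeCov (castParam genericParam) e) 2
    rw [Function.comp_apply] at this
    rw [this, castParam_edgeCov]
    exact_mod_cast genericParam_line e
  · rwa [← eval_edgeCov]

theorem generic_noConc : Generic fun θ => NoConc (edgeCov θ) := by
  refine .all fun e => .all fun f => .all fun g => .imp fun hef => .imp fun heg => .imp fun hfg =>
    (Generic.of_eval (det3 (edgeCov X e) (edgeCov X f) (edgeCov X g))
      (θ₀ := castParam genericParam) ?_).mono fun θ hθ => ?_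
  · rw [← map_det3, eval_edgeCov, eval_edgeCov, eval_edgeCov, castParam_edgeCov',
      castParam_edgeCov', castParam_edgeCov', map_det3]
    simpa using genericParam_noConc e f g hef heg hfg
  · rwa [← map_det3, eval_edgeCov, eval_edgeCov, eval_edgeCov] at hθ

theorem generic_det4_octadPt : Generic fun θ => ∀ e : Edge,
    det4 (octadPt θ e.1.1) (octadPt θ e.1.2) (octadPt θ (thirdVertex e))
      (octadPt θ (fourthVertex e)) ≠ 0 := by
  have key : ∀ {R S : Type} [CommRing R] [CommRing S] (σ : R →+* S) (θ : Fin 18 → R) (i : Fin 7),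
      σ ∘ octadPt θ i = octadPt (σ ∘ θ) i := fun σ θ i =>
    _root_.funext fun u => (map_octadPt σ θ i u).symm
  refine .all fun e => (Generic.of_eval (det4 (octadPt X e.1.1) (octadPt X e.1.2)
    (octadPt X (thirdVertex e)) (octadPt X (fourthVertex e)))
    (θ₀ := castParam genericParam) ?_).mono fun θ hθ => ?_
  · rw [← map_det4]
    simp only [key, eval_comp_X]
    simp only [castParam, ← key]
    rw [map_det4]
    simpa using genericParam_octad e
  · rw [← map_det4] at hθ
    simpa only [key, eval_comp_X] using hθ

theorem det4_eq_det {R : Type*} [CommRing R] (a b c d : Fin 4 → R) :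
    det4 a b c d = (Matrix.of ![a, b, c, d]).det := by
  simp [det4, det3, Matrix.det_succ_row_zero, Fin.sum_univ_succ, Fin.succAbove]
  ring

theorem map_apply3 {R S : Type*} [CommRing R] [CommRing S] (σ : R →+* S) (l v : Fin 3 → R) :
    apply3 (σ ∘ l) (σ ∘ v) = σ (apply3 l v) := by
  simp [apply3]

theorem map_pairValues {R S : Type*} [CommRing R] [CommRing S] (σ : R →+* S) (θ : Fin 18 → R)
    (e f : Edge) (v : Fin 3 → R) : pairValues (σ ∘ θ) e f (σ ∘ v) = σ ∘ pairValues θ e f v := by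
  have key : ∀ e : Edge, edgeCov (σ ∘ θ) e = σ ∘ edgeCov θ e := fun e =>
    _root_.funext fun m => map_lineCov σ θ _ _ m
  funext i
  fin_cases i <;> simp [pairValues, key, map_apply3]

theorem map_pairDet {R S : Type*} [CommRing R] [CommRing S] (σ : R →+* S) (θ : Fin 18 → R)
    (e f : Edge) : pairDet (σ ∘ θ) e f = σ (pairDet θ e f) := by
  have h : ∀ x y z : R, (σ ∘ ![x, y, z]) = ![σ x, σ y, σ z] := fun x y z => by
    funext i; fin_cases i <;> rfl
  rw [pairDet, pairDet, ← map_det4]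
  simp only [← map_pairValues, h, map_one, map_zero]

theorem generic_pairDet : Generic fun θ => ∀ e f : Edge, e ≠ f → ¬ EdgeDisj e f →
    pairDet θ e f ≠ 0 := by
  refine .all fun e => .all fun f => .imp fun hef => .imp fun hd =>
    (Generic.of_eval (pairDet X e f) (θ₀ := castParam genericParam) ?_).mono fun θ hθ => ?_
  · rw [← map_pairDet, eval_comp_X, map_pairDet]
    simpa using genericParam_pairDet e f hef hd
  · rwa [← map_pairDet, eval_comp_X] at hθ

theorem indep_of_pairDet_ne_zero {θ : Fin 18 → ℂ} {e f : Edge} (h : pairDet θ e f ≠ 0)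
    {k : Fin 4 → ℂ} (hk : ∀ v, ∑ i, pairValues θ e f v i * k i = 0) : k = 0 := by
  rw [pairDet, det4_eq_det] at h
  refine Matrix.eq_zero_of_mulVec_eq_zero h ?_
  funext i
  fin_cases i <;> exact hk _

/-- Row `(e, f)` expresses the agreement of the quadratic forms on the lines `e` and `f` at their
common point up to the sign `ε e f`; the diagonal rows express a normalization. -/
def signMat {R : Type*} [CommRing R] (t : ℤ) (ε : Edge → Edge → ℤˣ) (θ : Fin 18 → R) :
    Matrix (Edge × Edge) (Edge × Fin 3) R := fun r c =>
  let v := cross3 (edgeCov θ r.1) (edgeCov θ r.2)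
  let m : R := ![v 0 ^ 2, v 0 * v 1, v 1 ^ 2] c.2
  if r.1 = r.2 then (if c = (edge01, 2) then (t : R) else 0)
  else (if c.1 = r.1 then m else 0) - (if c.1 = r.2 then ((ε r.1 r.2 : ℤ) : R) * m else 0)

theorem map_signMat {R S : Type*} [CommRing R] [CommRing S] (σ : R →+* S) (t : ℤ)
    (ε : Edge → Edge → ℤˣ) (θ : Fin 18 → R) : signMat t ε (σ ∘ θ) = (signMat t ε θ).map σ := by
  have key : ∀ e : Edge, edgeCov (σ ∘ θ) e = σ ∘ edgeCov θ e := fun e =>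
    _root_.funext fun m => map_lineCov σ θ _ _ m
  have key' : ∀ l m : Fin 3 → R, cross3 (σ ∘ l) (σ ∘ m) = σ ∘ cross3 l m := fun l m => by
    funext i; fin_cases i <;> simp [cross3]
  ext r ⟨c, i⟩
  simp only [signMat, Matrix.map_apply, key, key', Function.comp_apply]
  split_ifs <;> fin_cases i <;> simp

theorem signMat_mulVec {t : ℤ} {ε : Edge → Edge → ℤˣ} {θ : Fin 18 → ℂ} (q : Edge → Fin 3 → ℂ) :
    (signMat t ε θ).mulVec (fun c => q c.1 c.2) = 0 ↔
      SignKer (edgeCov θ) ε q ∧ t * q edge01 2 = 0 := by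
  have hdiag : ∀ e, (signMat t ε θ).mulVec (fun c => q c.1 c.2) (e, e) = t * q edge01 2 := by
    intro e
    simp [signMat, Matrix.mulVec, dotProduct]
  have hoff : ∀ e f, e ≠ f → (signMat t ε θ).mulVec (fun c => q c.1 c.2) (e, f) =
      quad (q e) (cross3 (edgeCov θ e) (edgeCov θ f)) -
        sgn (ε e f) * quad (q f) (cross3 (edgeCov θ e) (edgeCov θ f)) := by
    intro e f h
    simp only [signMat, Matrix.mulVec, dotProduct, h, if_false, Fintype.sum_prod_type, sub_mul,
      Finset.sum_sub_distrib, ite_mul, zero_mul]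
    congr 1
    · rw [Finset.sum_eq_single e (by intro b _ hb; simp [hb]) (by simp)]
      simp [Fin.sum_univ_succ, quad]; ring
    · rw [Finset.sum_eq_single f (by intro b _ hb; simp [hb]) (by simp)]
      simp [Fin.sum_univ_succ, quad]; ring
  constructor
  · intro h
    refine ⟨fun e f hef => sub_eq_zero.1 ?_, ?_⟩
    · rw [← hoff e f hef, h]; rfl
    · rw [← hdiag edge01, h]; rfl
  · rintro ⟨h, h'⟩
    funext ⟨e, f⟩
    by_cases hef : e = f
    · subst hef; rw [hdiag, h']; rfl
    · rw [hoff e f hef, h e f hef, sub_self]; rfl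

theorem generic_signKer (t : ℤ) (ε : Edge → Edge → ℤˣ)
    (h : ∀ q, SignKer (edgeCov (castParam chordParam)) ε q → t * q edge01 2 = 0 → q = 0) :
    Generic fun θ => ∀ q, SignKer (edgeCov θ) ε q → t * q edge01 2 = 0 → q = 0 := by
  have key : ∀ θ, (∀ x, ((signMat t ε X).map (eval θ)).mulVec x = 0 → x = 0) ↔
      ∀ q, SignKer (edgeCov θ) ε q → t * q edge01 2 = 0 → q = 0 := by
    intro θ
    rw [← map_signMat, eval_comp_X]
    constructor
    · intro H q h1 h2
      have := H _ ((signMat_mulVec q).2 ⟨h1, h2⟩)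
      funext e i
      exact congrFun this (e, i)
    · intro H x hx
      have := (signMat_mulVec (fun e i => x (e, i))).1 hx
      have := H _ this.1 this.2
      funext ⟨e, i⟩
      exact congrFun (congrFun this e) i
  simpa only [key] using Generic.injective_mulVec (signMat t ε X)
    (θ₀ := castParam chordParam) ((key _).2 h)

section chord

variable {s : Fin 7 → ℂ} {q : Edge → Fin 3 → ℂ} {ε : Edge → Edge → ℤˣ}

abbrev edgeSum (s : Fin 7 → ℂ) (e : Edge) : ℂ := s e.1.1 + s e.1.2

abbrev edgeProd (s : Fin 7 → ℂ) (e : Edge) : ℂ := s e.1.1 * s e.1.2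

/-- The sign conditions on the chords of a conic. -/
def ChordKer (s : Fin 7 → ℂ) (ε : Edge → Edge → ℤˣ) (q : Edge → Fin 3 → ℂ) : Prop :=
  ∀ e f, e ≠ f →
    quad (q e) ![edgeSum s f - edgeSum s e, edgeProd s f - edgeProd s e, 0] =
      sgn (ε e f) * quad (q f) ![edgeSum s f - edgeSum s e, edgeProd s f - edgeProd s e, 0]

theorem exists_mkEdge : ∀ (a : Fin 7) (e : Edge), EdgeAt a e → ∃ b, b ≠ a ∧ e = mkEdge a b := by
  decide +kernel

theorem edgeSum_mkEdge {a b : Fin 7} (h : b ≠ a) : edgeSum s (mkEdge a b) = s a + s b ∧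
    edgeProd s (mkEdge a b) = s a * s b := by
  rcases lt_or_gt_of_ne h with h | h
  · simp [edgeSum, edgeProd, mkEdge, h, not_lt.2 h.le, add_comm, mul_comm]
  · simp [edgeSum, edgeProd, mkEdge, h]

theorem sgn_injective : Function.Injective sgn := fun u v h => by
  ext
  exact_mod_cast h

theorem ChordKer.vanish (hs : Function.Injective s) (h : ChordKer s ε q)
    (hε : ¬ StarTrivial ε) {a : Fin 7} {e : Edge} (he : EdgeAt a e) :
    quad (q e) ![1, s a, 0] = 0 := by
  have hstep : ∀ e f, e ≠ f → EdgeAt a e → EdgeAt a f →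
      quad (q e) ![1, s a, 0] = sgn (ε e f) * quad (q f) ![1, s a, 0] := by
    intro e f hef he hf
    obtain ⟨b, hb, rfl⟩ := exists_mkEdge a e he
    obtain ⟨c, hc, rfl⟩ := exists_mkEdge a f hf
    have hbc : s c - s b ≠ 0 := sub_ne_zero.2 fun h => hef (by rw [hs h])
    have h1 := h _ _ hef
    rw [(edgeSum_mkEdge hb).1, (edgeSum_mkEdge hb).2, (edgeSum_mkEdge hc).1,
      (edgeSum_mkEdge hc).2] at h1
    have hv : (![s a + s c - (s a + s b), s a * s c - s a * s b, 0] : Fin 3 → ℂ) =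
        (s c - s b) • ![1, s a, 0] := by
      funext i; fin_cases i <;> simp; ring
    rw [hv, (isForm_quad _).smul, (isForm_quad _).smul, mul_left_comm] at h1
    exact mul_left_cancel₀ (pow_ne_zero 2 hbc) h1
  by_contra h0
  classical
  refine hε ⟨a, fun f => if f = e then 1 else ε f e, fun f g hfg hf hg => ?_⟩
  set c : Edge → ℤˣ := fun f => if f = e then 1 else ε f e
  have hc : ∀ f, EdgeAt a f → quad (q f) ![1, s a, 0] = sgn (c f) * quad (q e) ![1, s a, 0] := by
    intro f hf
    by_cases hfe : f = e
    · simp [c, hfe, sgn]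
    · simpa [c, hfe] using hstep f e hfe hf he
  have h1 := hstep f g hfg hf hg
  rw [hc f hf, hc g hg, ← mul_assoc, ← sgn_mul] at h1
  have h2 := sgn_injective (mul_right_cancel₀ h0 h1)
  change ε f g = c f * c g
  rw [h2, mul_assoc, Int.units_mul_self, mul_one]

/-- Up to scalars, the quadratic forms on the chords are given by the two end points. -/
theorem ChordKer.exists_scalar (hs : Function.Injective s) (h : ChordKer s ε q)
    (hε : ¬ StarTrivial ε) : (∀ e, q e = q e 2 • ![edgeProd s e, - edgeSum s e, 1]) ∧
      ∀ e f, EdgeDisj e f → q e 2 = sgn (ε e f) * q f 2 := by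
  have hq : ∀ e, q e = q e 2 • ![edgeProd s e, - edgeSum s e, 1] := by
    intro e
    have h1 := h.vanish hs hε (a := e.1.1) (e := e) (Or.inl rfl)
    have h2 := h.vanish hs hε (a := e.1.2) (e := e) (Or.inr rfl)
    have hne : s e.1.1 - s e.1.2 ≠ 0 := sub_ne_zero.2 (hs.ne e.2.ne)
    simp only [quad, Matrix.cons_val_zero, Matrix.cons_val_one] at h1 h2
    have h3 : q e 1 = - (q e 2 * (s e.1.1 + s e.1.2)) :=
      mul_left_cancel₀ hne (by linear_combination h1 - h2)
    funext i
    fin_cases i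
    · simp; linear_combination h1 - s e.1.1 * h3
    · simp; linear_combination h3
    · simp
  refine ⟨hq, fun e f hef => ?_⟩
  have h1 := h e f hef.ne
  rw [hq e, hq f, quad_smul_left, quad_smul_left] at h1
  have hne : (s e.1.1 - s f.1.1) * (s e.1.1 - s f.1.2) * ((s e.1.2 - s f.1.1) *
      (s e.1.2 - s f.1.2)) ≠ 0 := by
    refine mul_ne_zero (mul_ne_zero ?_ ?_) (mul_ne_zero ?_ ?_) <;>
      refine sub_ne_zero.2 (hs.ne ?_)
    exacts [hef.1, hef.2.1, hef.2.2.1, hef.2.2.2]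
  refine mul_left_cancel₀ hne ?_
  simp only [quad, edgeSum, edgeProd, Matrix.cons_val_zero, Matrix.cons_val_one,
    Matrix.cons_val] at h1
  linear_combination h1

theorem exists_disj_disj : ∀ e f : Edge, ∃ g, EdgeDisj e g ∧ EdgeDisj f g := by decide +kernel

theorem ChordKer.sq_eq (hs : Function.Injective s) (h : ChordKer s ε q)
    (hε : ¬ StarTrivial ε) (e f : Edge) : q e 2 ^ 2 = q f 2 ^ 2 := by
  obtain ⟨g, he, hf⟩ := exists_disj_disj e f
  have := (h.exists_scalar hs hε).2
  rw [this e g he, this f g hf, mul_pow, mul_pow, pow_two (sgn _), pow_two (sgn _), sgn_mul_self,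
    sgn_mul_self]

theorem ChordKer.eq_zero (hs : Function.Injective s) (h : ChordKer s ε q)
    (hε : ¬ StarTrivial ε) (h0 : q edge01 2 = 0) : q = 0 := by
  funext e
  have := h.sq_eq hs hε e edge01
  rw [h0] at this
  have h2 : q e 2 = 0 := by simpa using this
  rw [(h.exists_scalar hs hε).1 e, h2, zero_smul]
  rfl

theorem ChordKer.eq_zero_of_not_disjTrivial (hs : Function.Injective s) (h : ChordKer s ε q)
    (hε : ¬ StarTrivial ε) (hd : ¬ DisjTrivial ε) : q = 0 := by
  refine h.eq_zero hs hε (by_contra fun h0 => hd ?_)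
  have hu : ∀ e, ∃ u : ℤˣ, q e 2 = sgn u * q edge01 2 := by
    intro e
    rcases sq_eq_sq_iff_eq_or_eq_neg.1 (h.sq_eq hs hε e edge01) with h | h
    · exact ⟨1, by simp [sgn, h]⟩
    · exact ⟨-1, by simp [sgn, h]⟩
  choose u hu using hu
  refine ⟨u, fun e f hef => ?_⟩
  have h1 := (h.exists_scalar hs hε).2 e f hef
  rw [hu e, hu f, ← mul_assoc, ← sgn_mul] at h1
  rw [sgn_injective (mul_right_cancel₀ h0 h1), mul_assoc, Int.units_mul_self, mul_one]

end chord

theorem not_starTrivial_thetaSign : ¬ StarTrivial thetaSign := by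
  rintro ⟨a, c, h⟩
  have key : ∀ i j : Fin 5, i ≠ j → c (starEdge a i) * c (starEdge a j) = -1 := by
    intro i j hij
    rw [← h _ _ ((starEdge_injective a).ne hij) (edgeAt_starEdge a i) (edgeAt_starEdge a j)]
    refine if_neg fun hd => ?_
    rcases edgeAt_starEdge a i with h1 | h1 <;> rcases edgeAt_starEdge a j with h2 | h2
    · exact hd.1 (h1.trans h2.symm)
    · exact hd.2.1 (h1.trans h2.symm)
    · exact hd.2.2.1 (h1.trans h2.symm)
    · exact hd.2.2.2 (h1.trans h2.symm)
  have h01 := key 0 1 (by decide)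
  have h02 := key 0 2 (by decide)
  have h12 := key 1 2 (by decide)
  revert h01 h02 h12
  generalize c (starEdge a 0) = x
  generalize c (starEdge a 1) = y
  generalize c (starEdge a 2) = z
  revert x y z
  decide

/-- The parameters of the chord configuration. -/
def chordPoint (i : Fin 7) : ℂ := (i : ℕ) - 3

theorem chordPoint_injective : Function.Injective chordPoint := fun i j h => by
  simpa [chordPoint, Fin.ext_iff] using h

theorem chordKer_of_signKer {ε : Edge → Edge → ℤˣ} {q : Edge → Fin 3 → ℂ}
    (h : SignKer (edgeCov (castParam chordParam)) ε q) : ChordKer chordPoint ε q := by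
  have hl : ∀ e : Edge, ∃ k : ℂ, k ≠ 0 ∧ edgeCov (castParam chordParam) e =
      k • ![edgeProd chordPoint e, -edgeSum chordPoint e, 1] := by
    intro e
    obtain ⟨h2, h1, h0⟩ := chordParam_line e
    refine ⟨((edgeCov chordParam e 2 : ℤ) : ℂ), by exact_mod_cast h2, ?_⟩
    funext i
    rw [castParam_edgeCov]
    fin_cases i
    · change ((edgeCov chordParam e 0 : ℤ) : ℂ) = _
      rw [h0]; simp [chordPoint, edgeProd]
    · change ((edgeCov chordParam e 1 : ℤ) : ℂ) = _
      rw [h1]; simp [chordPoint, edgeSum]; ring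
    · simp
  intro e f hef
  obtain ⟨k, hk, he⟩ := hl e
  obtain ⟨l, hl, hf⟩ := hl f
  have h1 := h e f hef
  rw [he, hf] at h1
  have key : ∀ r : Fin 3 → ℂ, quad r (cross3 (k • ![edgeProd chordPoint e, -edgeSum chordPoint e, 1])
      (l • ![edgeProd chordPoint f, -edgeSum chordPoint f, 1])) = (k * l) ^ 2 *
      quad r ![edgeSum chordPoint f - edgeSum chordPoint e,
        edgeProd chordPoint f - edgeProd chordPoint e, 0] := by
    intro r
    simp [quad, cross3]
    ring
  rw [key, key, mul_left_comm] at h1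
  exact mul_left_cancel₀ (pow_ne_zero 2 (mul_ne_zero hk hl)) h1

theorem generic_goodLines : Generic fun θ => GoodLines (edgeCov θ) := by
  have hsign : Generic fun θ => ∀ ε, ¬ StarTrivial ε → ¬ DisjTrivial ε →
      ∀ q, SignKer (edgeCov θ) ε q → ((0 : ℤ) : ℂ) * q edge01 2 = 0 → q = 0 :=
    .all fun ε => .imp fun h1 => .imp fun h2 => generic_signKer 0 ε fun q hq _ =>
      (chordKer_of_signKer hq).eq_zero_of_not_disjTrivial chordPoint_injective h1 h2
  have htheta := generic_signKer 1 thetaSign fun q hq h => (chordKer_of_signKer hq).eq_zero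
    chordPoint_injective not_starTrivial_thetaSign (by simpa using h)
  refine (generic_noConc.and (generic_pairDet.and (hsign.and htheta))).mono
    fun θ ⟨h1, h2, h3, h4⟩ => ⟨h1, fun e f hef hd k₀ k₁ k₂ k₃ h => ?_,
      fun ε hs hd q hq => h3 ε hs hd q hq (by simp), fun q hq h => h4 q hq (by simp [h])⟩
  have := indep_of_pairDet_ne_zero (h2 e f hef hd) (k := ![k₀, k₁, k₂, k₃]) fun v => by
    simpa [Fin.sum_univ_succ, pairValues, mul_comm, add_assoc] using h v
  exact ⟨congrFun this 1, congrFun this 2, congrFun this 3⟩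

/-- The coefficients of a product of two linear forms; the monomials are ordered as
`z²`, `yz`, `y²`, `xz`, `xy`, `x²`. -/
def mulLine {R : Type*} [CommRing R] (a b : Fin 3 → R) : Fin 6 → R :=
  ![a 2 * b 2, a 1 * b 2 + a 2 * b 1, a 1 * b 1, a 0 * b 2 + a 2 * b 0, a 0 * b 1 + a 1 * b 0,
    a 0 * b 0]

/-- The coefficients of a product of two quadratic forms, with the monomials `xⁱyʲzᵏ` in
lexicographic order of `(i, j)`. -/
def mulConic {R : Type*} [CommRing R] (a b : Fin 6 → R) : Fin 15 → R :=
  ![a 0 * b 0, a 0 * b 1 + a 1 * b 0, a 0 * b 2 + a 1 * b 1 + a 2 * b 0, a 1 * b 2 + a 2 * b 1,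
    a 2 * b 2,
    a 0 * b 3 + a 3 * b 0, a 0 * b 4 + a 1 * b 3 + a 3 * b 1 + a 4 * b 0,
    a 1 * b 4 + a 2 * b 3 + a 3 * b 2 + a 4 * b 1, a 2 * b 4 + a 4 * b 2,
    a 3 * b 3 + a 0 * b 5 + a 5 * b 0, a 3 * b 4 + a 4 * b 3 + a 1 * b 5 + a 5 * b 1,
    a 4 * b 4 + a 2 * b 5 + a 5 * b 2,
    a 3 * b 5 + a 5 * b 3, a 4 * b 5 + a 5 * b 4, a 5 * b 5]

def conicForm {R : Type*} [CommRing R] (a : Fin 6 → R) (v : Fin 3 → R) : R :=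
  a 0 * v 2 ^ 2 + a 1 * (v 1 * v 2) + a 2 * v 1 ^ 2 + a 3 * (v 0 * v 2) + a 4 * (v 0 * v 1)
    + a 5 * v 0 ^ 2

/-- The quartic form with the given coefficients. -/
def quarticForm {R : Type*} [CommRing R] (c : Fin 15 → R) (v : Fin 3 → R) : R :=
  c 0 * v 2 ^ 4 + c 1 * (v 1 * v 2 ^ 3) + c 2 * (v 1 ^ 2 * v 2 ^ 2) + c 3 * (v 1 ^ 3 * v 2)
    + c 4 * v 1 ^ 4 + c 5 * (v 0 * v 2 ^ 3) + c 6 * (v 0 * v 1 * v 2 ^ 2)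
    + c 7 * (v 0 * v 1 ^ 2 * v 2) + c 8 * (v 0 * v 1 ^ 3) + c 9 * (v 0 ^ 2 * v 2 ^ 2)
    + c 10 * (v 0 ^ 2 * v 1 * v 2) + c 11 * (v 0 ^ 2 * v 1 ^ 2) + c 12 * (v 0 ^ 3 * v 2)
    + c 13 * (v 0 ^ 3 * v 1) + c 14 * v 0 ^ 4

/-- The coefficients of the Hessian quartic of the net of quadrics. -/
def quarticCoeff {R : Type*} [CommRing R] (θ : Fin 18 → R) : Fin 15 → R :=
  let u := mulLine (lineCov θ 0 1) (lineCov θ 2 3)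
  let w := mulLine (lineCov θ 0 2) (lineCov θ 1 3)
  let z := mulLine (lineCov θ 0 3) (lineCov θ 1 2)
  mulConic (u - w - z) (u - w - z) - (4 : R) • mulConic w z

section
variable {R : Type*} [CommRing R]

theorem conicForm_mulLine (a b v : Fin 3 → R) :
    conicForm (mulLine a b) v = apply3 a v * apply3 b v := by
  simp [conicForm, mulLine, apply3]
  ring

theorem quarticForm_mulConic (a b : Fin 6 → R) (v : Fin 3 → R) :
    quarticForm (mulConic a b) v = conicForm a v * conicForm b v := by
  simp [conicForm, mulConic, quarticForm]
  ring

theorem conicForm_sub (a b : Fin 6 → R) (v : Fin 3 → R) :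
    conicForm (a - b) v = conicForm a v - conicForm b v := by
  simp [conicForm]
  ring

theorem quarticForm_sub_smul (a b : Fin 15 → R) (t : R) (v : Fin 3 → R) :
    quarticForm (a - t • b) v = quarticForm a v - t * quarticForm b v := by
  simp [quarticForm]
  ring

/-- The determinant of a symmetric matrix of size four with zero diagonal. -/
def gramForm (l : Fin 7 → Fin 7 → R) (i j k m : Fin 7) : R :=
  (l i j * l k m - l i k * l j m - l i m * l j k) ^ 2 - 4 * (l i k * l j m) * (l i m * l j k)

/-- The pairing of the octad points with respect to a quadric of the net. -/
def pairing (θ : Fin 18 → R) (v : Fin 3 → R) (i j : Fin 7) : R := apply3 (lineCov θ i j) v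

theorem quarticForm_quarticCoeff (θ : Fin 18 → R) (v : Fin 3 → R) :
    quarticForm (quarticCoeff θ) v = gramForm (pairing θ v) 0 1 2 3 := by
  simp only [quarticCoeff, quarticForm_sub_smul, quarticForm_mulConic, conicForm_sub,
    conicForm_mulLine, gramForm, pairing]
  ring

theorem gramForm_pairing (θ : Fin 18 → R) (v : Fin 3 → R) (i j k m : Fin 7) :
    gramForm (pairing θ v) i j k m =
      det4 (octadPt θ i) (octadPt θ j) (octadPt θ k) (octadPt θ m) ^ 2 *
        (∑ n, v n • netMat θ n).det := by
  set A : Matrix (Fin 4) (Fin 4) R := ∑ n, v n • netMat θ n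
  set B : Matrix (Fin 4) (Fin 4) R :=
    Matrix.of ![octadPt θ i, octadPt θ j, octadPt θ k, octadPt θ m]
  have hp : ∀ a b : Fin 4, (B * A * B.transpose) a b =
      pairing θ v (![i, j, k, m] a) (![i, j, k, m] b) := by
    intro a b
    have hB : ∀ a u, B a u = octadPt θ (![i, j, k, m] a) u := by
      intro a u; fin_cases a <;> rfl
    have hA : ∀ u w, A u w = v 0 * netMat θ 0 u w + v 1 * netMat θ 1 u w + v 2 * netMat θ 2 u w := by
      intro u w
      simp only [A, Fin.sum_univ_three, Matrix.add_apply, Matrix.smul_apply, smul_eq_mul]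
    simp only [Matrix.mul_apply, Matrix.transpose_apply, hB, hA, pairing, apply3, lineCov,
      Fin.sum_univ_four]
    ring
  have hG : B * A * B.transpose = Matrix.of fun a b =>
      pairing θ v (![i, j, k, m] a) (![i, j, k, m] b) := Matrix.ext hp
  have h0 : ∀ a, pairing θ v a a = 0 := by
    intro a; simp [pairing, lineCov_self, apply3]
  have hs : ∀ a b, pairing θ v a b = pairing θ v b a := by
    intro a b; rw [pairing, lineCov_comm, pairing]
  have hdet := congrArg Matrix.det hG
  rw [Matrix.det_mul, Matrix.det_mul, Matrix.det_transpose] at hdet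
  rw [det4_eq_det, pow_two, mul_right_comm, hdet, Matrix.det_succ_row_zero]
  simp [Fin.sum_univ_succ, Matrix.det_fin_three, Fin.succAbove, h0, gramForm]
  rw [hs j i, hs k i, hs m i, hs k j, hs m j, hs m k]
  ring

theorem gramForm_eq_det4_sq_mul (θ : Fin 18 → R) (v : Fin 3 → R) (i j k m : Fin 7) :
    gramForm (pairing θ v) i j k m =
      det4 (octadPt θ i) (octadPt θ j) (octadPt θ k) (octadPt θ m) ^ 2 *
        quarticForm (quarticCoeff θ) v := by
  have h : det4 (octadPt θ 0) (octadPt θ 1) (octadPt θ 2) (octadPt θ 3) = 1 := by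
    simp [det4, det3, octadPt]
  rw [quarticForm_quarticCoeff, gramForm_pairing, gramForm_pairing, h]
  ring

end

theorem IsForm.exists_eq_quad {Q : (Fin 3 → ℂ) → ℂ} (hQ : IsForm 2 Q) {l : Fin 3 → ℂ}
    (hl : l 2 ≠ 0) : ∃ q : Fin 3 → ℂ, ∀ v, apply3 l v = 0 → Q v = quad q v := by
  obtain ⟨c, hc⟩ := hQ.exists_coeff
  set α := - l 0 / l 2
  set β := - l 1 / l 2
  refine ⟨![c 2 0 + c 1 0 * α + c 0 0 * α ^ 2,
    c 1 1 + c 1 0 * β + c 0 1 * α + 2 * c 0 0 * α * β, c 0 2 + c 0 1 * β + c 0 0 * β ^ 2],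
    fun v hv => ?_⟩
  have h2 : v 2 = α * v 0 + β * v 1 := by
    simp only [α, β]
    field_simp
    rw [apply3] at hv
    linear_combination hv
  simp [hc, Finset.sum_range_succ, quad, h2]
  ring

/-- The quartic is a square on each of the lines joining two octad points. -/
theorem exists_squareOn {θ : Fin 18 → ℂ} (h2 : ∀ e, edgeCov θ e 2 ≠ 0)
    (hd : ∀ e : Edge, det4 (octadPt θ e.1.1) (octadPt θ e.1.2) (octadPt θ (thirdVertex e))
      (octadPt θ (fourthVertex e)) ≠ 0) :
    ∃ q, SquareOn (edgeCov θ) (quarticForm (quarticCoeff θ)) q := by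
  have key : ∀ e : Edge, ∃ q, ∀ v, apply3 (edgeCov θ e) v = 0 →
      quarticForm (quarticCoeff θ) v = quad q v ^ 2 := by
    intro e
    set i := e.1.1
    set j := e.1.2
    set k := thirdVertex e
    set m := fourthVertex e
    set D := det4 (octadPt θ i) (octadPt θ j) (octadPt θ k) (octadPt θ m)
    have hQ : IsForm 2 fun v => D⁻¹ * (pairing θ v i k * pairing θ v j m -
        pairing θ v i m * pairing θ v j k) :=
      (((isForm_apply3 _).mul (isForm_apply3 _)).sub
        ((isForm_apply3 _).mul (isForm_apply3 _))).const_mul _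
    obtain ⟨q, hq⟩ := hQ.exists_eq_quad (h2 e)
    refine ⟨q, fun v hv => ?_⟩
    have h1 := gramForm_eq_det4_sq_mul θ v i j k m
    have h0 : pairing θ v i j = 0 := hv
    have hD : D ≠ 0 := hd e
    rw [← hq v hv]
    refine mul_left_cancel₀ (pow_ne_zero 2 hD) (h1.symm.trans ?_)
    rw [gramForm, h0]
    field_simp
    ring
  choose q hq using key
  exact ⟨q, hq⟩

/-- The first order neighbourhood of the parameter `θ` in the direction of the `a`-th coordinate. -/
def dualParam {R : Type*} [CommRing R] (θ : Fin 18 → R) (a : Fin 18) : Fin 18 → DualNumber R :=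
  fun i => (θ i, if i = a then 1 else 0)

/-- The Jacobian matrix of the coefficients of the quartic at `genericParam`, modulo `19`. -/
def jacobianMod : Matrix (Fin 15) (Fin 15) (ZMod 19) :=
  ![![2, 8, 6, -1, 0, 8, 8, -1, -1, -8, 2, -9, -6, 4, -1],
    ![-4, 4, 6, -1, -2, -3, -4, 9, 3, -7, -5, 4, 9, 0, -5],
    ![5, -2, 3, -4, 9, -2, -8, -5, -1, -3, 2, -9, -7, 6, -6],
    ![-8, -5, -6, -1, -6, -5, 6, -3, -8, 2, 6, 4, 2, 7, 4],
    ![-9, -8, 4, -4, -7, -8, -9, 5, 5, 5, -4, 2, -1, 0, 3],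
    ![3, -5, 9, 3, -9, -6, -8, 3, -9, 9, 7, -7, 1, -8, -5],
    ![0, 0, 0, 0, 0, 4, -1, -3, 0, -7, -5, -7, -3, 0, 9],
    ![0, 4, -1, -3, 0, 0, -7, -5, -7, 0, -3, 0, 0, 9, 0],
    ![4, -1, -3, 0, 0, -7, -5, -7, 0, -3, 0, 0, 9, 0, 0],
    ![0, 0, 0, 0, 0, -1, 9, 3, -6, 3, -6, -5, 5, -9, -5],
    ![0, -1, 9, 3, -6, 0, 3, -6, -5, 0, 5, -9, 0, -5, 0],
    ![-1, 9, 3, -6, 0, 3, -6, -5, 0, 5, -9, 0, -5, 0, 0],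
    ![0, 0, 0, 0, 0, 7, 7, -5, -9, -6, -8, 1, -9, 4, 7],
    ![0, 7, 7, -5, -9, 0, -6, -8, 1, 0, -9, 4, 0, 7, 0],
    ![7, 7, -5, -9, 0, -6, -8, 1, 0, -9, 4, 0, 7, 0, 0]]

/-- The inverse of `jacobianMod`. -/
def jacobianInv : Matrix (Fin 15) (Fin 15) (ZMod 19) :=
  ![![-3, 0, -2, -1, -8, -9, -4, 4, -1, -4, -5, -8, -5, -6, -3],
    ![4, -9, -4, 5, -9, -6, -3, 6, 6, -1, 9, 4, -4, 8, 4],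
    ![3, 7, 7, -6, -6, 1, 1, -2, 2, 3, 7, 7, 0, 0, 2],
    ![-2, -6, -5, 4, 3, 8, 3, -6, -6, 0, -9, -5, 3, 2, 3],
    ![2, -8, -1, 1, -1, 4, -9, 1, 7, -5, -5, 2, -1, -2, 9],
    ![-3, -6, 6, 6, -1, 2, 9, -5, 8, -7, -9, 4, 4, 6, 2],
    ![-5, -7, 9, -1, 1, -6, 8, -7, 9, 1, 5, -1, -9, -8, 2],
    ![6, 9, 5, 7, 9, 7, 6, -5, 6, 0, 5, -3, 1, 0, -1],
    ![2, 0, -9, -7, 9, -1, 2, -6, -6, 7, -3, 1, 8, -2, 8],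
    ![6, 2, -2, -7, 8, 5, 9, 8, 0, 9, 5, 4, 5, -6, 7],
    ![8, 9, 5, 9, 4, -3, -5, 0, -6, 6, -4, -4, 0, 8, 8],
    ![-1, -2, 6, 6, 8, 8, 8, 6, 7, -3, -5, 7, 9, 0, -8],
    ![-2, -8, 3, 2, -9, 9, 4, 4, 3, 5, 9, -9, -4, 6, -6],
    ![-9, -1, -1, -3, -9, 5, -5, -5, -5, 9, 1, 7, -8, -8, 3],
    ![2, 3, 9, -4, -8, 8, -4, -7, -8, -4, 7, -8, 5, -6, 7]]

theorem jacobianMod_mul_jacobianInv : jacobianMod * jacobianInv = 1 := by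
  have : ∀ i j, ∑ k, jacobianMod i k * jacobianInv k j = if i = j then 1 else 0 := by
    decide +kernel
  ext i j
  rw [Matrix.mul_apply, this, Matrix.one_apply]

theorem quarticCoeff_dualParam : ∀ i m : Fin 15,
    (((quarticCoeff (dualParam genericParam (Fin.natAdd 3 i)) m).snd : ℤ) : ZMod 19) =
      (jacobianMod i m : ZMod 19) := by
  have h : ∀ i m : Fin 15,
      ((quarticCoeff (dualParam genericParam (Fin.natAdd 3 i)) m).snd - (jacobianMod i m).val) % 19
        = (0 : ℤ) := by
    decide +kernel
  intro i m
  have h1 := (ZMod.intCast_zmod_eq_zero_iff_dvd _ 19).2 (Int.dvd_of_emod_eq_zero (h i m))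
  rw [Int.cast_sub, sub_eq_zero, Int.cast_natCast, ZMod.natCast_zmod_val] at h1
  exact h1

section
variable {R S : Type*} [CommRing R] [CommRing S]

theorem map_mulLine (σ : R →+* S) (a b : Fin 3 → R) (i : Fin 6) :
    mulLine (σ ∘ a) (σ ∘ b) i = σ (mulLine a b i) := by
  fin_cases i <;> simp [mulLine]

theorem map_mulConic (σ : R →+* S) (a b : Fin 6 → R) (i : Fin 15) :
    mulConic (σ ∘ a) (σ ∘ b) i = σ (mulConic a b i) := by
  fin_cases i <;> simp [mulConic]

theorem map_quarticCoeff (σ : R →+* S) (θ : Fin 18 → R) (m : Fin 15) :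
    quarticCoeff (σ ∘ θ) m = σ (quarticCoeff θ m) := by
  have h1 : ∀ i j, lineCov (σ ∘ θ) i j = σ ∘ lineCov θ i j := fun i j =>
    _root_.funext fun m => map_lineCov σ θ i j m
  have h2 : ∀ a b : Fin 3 → R, mulLine (σ ∘ a) (σ ∘ b) = σ ∘ mulLine a b := fun a b =>
    _root_.funext fun m => map_mulLine σ a b m
  have h3 : ∀ a b : Fin 6 → R, σ ∘ a - σ ∘ b = σ ∘ (a - b) := fun a b => by
    funext i; simp
  simp only [quarticCoeff, h1, h2, h3, Pi.sub_apply, Pi.smul_apply, map_mulConic, map_sub,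
    smul_eq_mul, map_mul, map_ofNat]

/-- Evaluation at a dual number parameter computes partial derivatives. -/
theorem aeval_dualParam (θ : Fin 18 → R) (a : Fin 18) (p : MvPolynomial (Fin 18) R) :
    (aeval (dualParam θ a) p).fst = eval θ p ∧
      (aeval (dualParam θ a) p).snd = eval θ (pderiv a p) := by
  induction p using MvPolynomial.induction_on with
  | C r =>
    have : (algebraMap R (DualNumber R)) r = TrivSqZeroExt.inl r := rfl
    rw [aeval_C, this, TrivSqZeroExt.fst_inl, TrivSqZeroExt.snd_inl, eval_C, pderiv_C, map_zero]
    exact ⟨rfl, rfl⟩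
  | add p q hp hq =>
    simp [hp, hq]
  | mul_X p i hp =>
    simp only [map_mul, aeval_X, TrivSqZeroExt.fst_mul, TrivSqZeroExt.snd_mul, hp, eval_X,
      Derivation.leibniz, pderiv_X, map_add, smul_eq_mul]
    refine ⟨rfl, ?_⟩
    have h1 : (dualParam θ a i).fst = θ i := rfl
    have h2 : (dualParam θ a i).snd = if i = a then 1 else 0 := rfl
    rw [h1, h2]
    by_cases h : i = a
    · subst h; simp; ring
    · simp [h, mul_comm]

theorem eval_pderiv_quarticCoeff (θ : Fin 18 → R) (a : Fin 18) (m : Fin 15) :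
    eval θ (pderiv a (quarticCoeff (X : Fin 18 → MvPolynomial (Fin 18) R) m)) =
      (quarticCoeff (dualParam θ a) m).snd := by
  rw [← (aeval_dualParam θ a _).2]
  congr 1
  have := map_quarticCoeff (aeval (dualParam θ a) : MvPolynomial (Fin 18) R →ₐ[R] _).toRingHom X m
  refine this.symm.trans ?_
  congr 1
  funext i
  simp

/-- The chain rule for partial derivatives of compositions. -/
theorem pderiv_aeval {ι κ : Type*} [Fintype κ] (f : κ → MvPolynomial ι R) (a : ι)
    (g : MvPolynomial κ R) :
    pderiv a (aeval f g) = ∑ m, aeval f (pderiv m g) * pderiv a (f m) := by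
  classical
  induction g using MvPolynomial.induction_on with
  | C r => simp [algebraMap_eq]
  | add p q hp hq => simp only [map_add, hp, hq, add_mul, Finset.sum_add_distrib]
  | mul_X p i hp =>
    simp only [map_mul, aeval_X, Derivation.leibniz, hp, smul_eq_mul, pderiv_X, map_add, add_mul,
      Finset.sum_add_distrib, Finset.mul_sum]
    congr 1
    · rw [Finset.sum_eq_single i (by intro b _ hb; simp [hb.symm]) (by simp)]
      simp
    · exact Finset.sum_congr rfl fun m _ => by ring

end

theorem jacobian_quarticCoeff_ne_zero : (Matrix.of fun i m : Fin 15 =>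
    pderiv (Fin.natAdd 3 i) (quarticCoeff (X : Fin 18 → MvPolynomial (Fin 18) ℤ) m)).det ≠ 0 := by
  intro h
  have h1 := congrArg ((Int.castRingHom (ZMod 19)).comp (eval genericParam)) h
  rw [RingHom.map_det, map_zero] at h1
  have h2 : ((Int.castRingHom (ZMod 19)).comp (eval genericParam)).mapMatrix
      (Matrix.of fun i m : Fin 15 => pderiv (Fin.natAdd 3 i)
        (quarticCoeff (X : Fin 18 → MvPolynomial (Fin 18) ℤ) m)) = jacobianMod := by
    ext i m
    rw [← quarticCoeff_dualParam, ← eval_pderiv_quarticCoeff]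
    rfl
  have h3 := congrArg Matrix.det jacobianMod_mul_jacobianInv
  rw [Matrix.det_mul, ← h2, h1, zero_mul, Matrix.det_one] at h3
  exact absurd h3 (by decide)

/-- If all partial derivatives of a polynomial vanish, it is constant. -/
theorem eq_C_of_pderiv_eq_zero {κ : Type*} {g : MvPolynomial κ ℂ} (h : ∀ m, pderiv m g = 0) :
    ∃ c, g = C c := by
  classical
  refine ⟨coeff 0 g, ?_⟩
  ext d
  rw [coeff_C]
  split_ifs with hd
  · rw [hd]
  · obtain ⟨m, hm⟩ : ∃ m, d m ≠ 0 := by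
      by_contra! h'
      exact hd (Finsupp.ext fun m => (h' m).symm)
    have h1 := congrArg (coeff (d - Finsupp.single m 1)) (h m)
    have h2 : d - Finsupp.single m 1 + Finsupp.single m 1 = d :=
      tsub_add_cancel_of_le (Finsupp.single_le_iff.2 (Nat.one_le_iff_ne_zero.2 hm))
    rw [coeff_pderiv, h2, coeff_zero] at h1
    exact (mul_eq_zero.1 h1).resolve_right (Nat.cast_add_one_ne_zero _)

theorem totalDegree_pderiv_lt {κ : Type*} {g : MvPolynomial κ ℂ} {m : κ} (h : pderiv m g ≠ 0) :
    (pderiv m g).totalDegree < g.totalDegree := by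
  classical
  obtain ⟨d, hd, hd'⟩ : ∃ d ∈ (pderiv m g).support, (pderiv m g).totalDegree = d.degree := by
    obtain ⟨d, hd, hd'⟩ := Finset.exists_mem_eq_sup (pderiv m g).support
      (support_nonempty.2 h) fun s => s.degree
    exact ⟨d, hd, hd'⟩
  rw [mem_support_iff, coeff_pderiv] at hd
  have h1 := le_totalDegree (mem_support_iff.2 (left_ne_zero_of_mul hd))
  have h2 : (d + Finsupp.single m 1).degree = d.degree + 1 := by simp
  change (d + Finsupp.single m 1).degree ≤ _ at h1
  omega

/-- Jacobian criterion for algebraic independence. -/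
theorem injective_aeval_of_jacobian {ι κ : Type*} [Fintype κ] [DecidableEq κ]
    (f : κ → MvPolynomial ι ℂ) (a : κ → ι)
    (hJ : (Matrix.of fun i m => pderiv (a i) (f m)).det ≠ 0) (g : MvPolynomial κ ℂ) (hg : g ≠ 0) :
    aeval f g ≠ 0 := by
  induction hn : g.totalDegree using Nat.strong_induction_on generalizing g with
  | _ n ih =>
    intro h0
    have h1 : ∀ m, pderiv m g = 0 := by
      by_contra! h
      obtain ⟨m, hm⟩ := h
      have h2 : (fun m => aeval f (pderiv m g)) = 0 := by
        refine Matrix.eq_zero_of_mulVec_eq_zero hJ (_root_.funext fun i => ?_)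
        have := pderiv_aeval f (a i) g
        rw [h0, map_zero] at this
        simp only [Matrix.mulVec, dotProduct, Matrix.of_apply, Pi.zero_apply]
        rw [this]
        exact Finset.sum_congr rfl fun m _ => mul_comm _ _
      exact ih _ (hn ▸ totalDegree_pderiv_lt hm) _ hm rfl (congrFun h2 m)
    obtain ⟨c, rfl⟩ := eq_C_of_pderiv_eq_zero h1
    rw [aeval_C, algebraMap_eq, C_eq_zero] at h0
    exact hg (by rw [h0, C_0])

theorem map_pderiv_quarticCoeff (a : Fin 18) (m : Fin 15) :
    map (Int.castRingHom ℂ) (pderiv a (quarticCoeff (X : Fin 18 → MvPolynomial (Fin 18) ℤ) m)) =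
      pderiv a (quarticCoeff (X : Fin 18 → MvPolynomial (Fin 18) ℂ) m) := by
  rw [← pderiv_map, ← map_quarticCoeff]
  have : (map (Int.castRingHom ℂ) : MvPolynomial (Fin 18) ℤ →+* _) ∘ X = X :=
    _root_.funext fun i => map_X _ i
  rw [this]

theorem aeval_quarticCoeff_ne_zero (g : MvPolynomial (Fin 15) ℂ) (hg : g ≠ 0) :
    aeval (quarticCoeff (X : Fin 18 → MvPolynomial (Fin 18) ℂ)) g ≠ 0 := by
  refine injective_aeval_of_jacobian _ (fun i => Fin.natAdd 3 i) (fun h => ?_) g hg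
  refine jacobian_quarticCoeff_ne_zero (map_injective (Int.castRingHom ℂ) Int.cast_injective ?_)
  rw [RingHom.map_det, map_zero, ← h]
  exact congrArg Matrix.det (Matrix.ext fun i m => map_pderiv_quarticCoeff _ m)

/-- A dominant polynomial map sends a nonempty principal open set onto a set containing a
nonempty principal open set. -/
theorem exists_principal_open_subset_image {ι κ : Type*} [Finite ι] [Finite κ]
    (f : κ → MvPolynomial ι ℂ) (hf : ∀ g : MvPolynomial κ ℂ, g ≠ 0 → aeval f g ≠ 0) {h : MvPolynomial ι ℂ}
    (hh : h ≠ 0) :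
    ∃ P : MvPolynomial κ ℂ, P ≠ 0 ∧ ∀ y, eval y P ≠ 0 →
      ∃ θ, eval θ h ≠ 0 ∧ ∀ m, eval θ (f m) = y m := by
  let φ : MvPolynomial κ ℂ →+* MvPolynomial ι ℂ := (aeval f : MvPolynomial κ ℂ →ₐ[ℂ] MvPolynomial ι ℂ).toRingHom
  have hφ : φ.FinitePresentation := by
    refine RingHom.FinitePresentation.of_comp_finiteType C (g := φ) ?_ ?_
    · have : φ.comp C = algebraMap ℂ (MvPolynomial ι ℂ) := by
        ext x; simp [φ, algebraMap_eq]
      rw [this, RingHom.finitePresentation_algebraMap]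
      infer_instance
    · rw [← algebraMap_eq, RingHom.finiteType_algebraMap]
      infer_instance
  obtain ⟨S, hS⟩ := PrimeSpectrum.exists_constructibleSetData_iff.2
    (PrimeSpectrum.isConstructible_comap_image hφ (PrimeSpectrum.isConstructible_basicOpen (f := h)))
  have hbot : (⊥ : PrimeSpectrum (MvPolynomial κ ℂ)) ∈ S.toSet := by
    rw [hS]
    refine ⟨⊥, hh, PrimeSpectrum.ext (le_bot_iff.1 fun g hg => ?_)⟩
    by_contra hg0
    exact hf g hg0 hg
  simp only [PrimeSpectrum.ConstructibleSetData.toSet, Set.mem_iUnion] at hbot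
  obtain ⟨D, hD, hbot⟩ := hbot
  refine ⟨D.f, fun h0 => hbot.2 (by rw [h0]; simp), fun y hy => ?_⟩
  have hmem : (pointToPoint y : PrimeSpectrum (MvPolynomial κ ℂ)) ∈ S.toSet := by
    simp only [PrimeSpectrum.ConstructibleSetData.toSet, Set.mem_iUnion]
    refine ⟨D, hD, ?_, fun h0 => hy ?_⟩
    · rintro _ ⟨i, rfl⟩
      have : D.g i = 0 := hbot.1 ⟨i, rfl⟩
      rw [this]
      exact Ideal.zero_mem _
    · have : D.f ∈ vanishingIdeal ℂ {y} := h0 rfl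
      rwa [mem_vanishingIdeal_singleton_iff] at this
  rw [hS] at hmem
  obtain ⟨q, hq, hqy⟩ := hmem
  have hq' : h ∉ vanishingIdeal ℂ (zeroLocus ℂ q.asIdeal) := by
    rw [IsPrime.vanishingIdeal_zeroLocus]
    exact hq
  simp only [mem_vanishingIdeal_iff, not_forall] at hq'
  obtain ⟨θ, hθ, hθh⟩ := hq'
  refine ⟨θ, hθh, fun m => ?_⟩
  have h1 : X m - C (y m) ∈ (pointToPoint y : PrimeSpectrum (MvPolynomial κ ℂ)).asIdeal :=
    (mem_vanishingIdeal_singleton_iff _ _).2 (by simp)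
  rw [← hqy] at h1
  have h2 := hθ _ h1
  simpa [φ, sub_eq_zero, aeval_eq_eval] using h2

/-- The projective line with the given equation. -/
def lineOf (l : Fin 3 → ℂ) : Set P2 := {p | apply3 l p.rep = 0}

theorem mk_mem_lineOf {l w : Fin 3 → ℂ} (hw : w ≠ 0) :
    Projectivization.mk ℂ w hw ∈ lineOf l ↔ apply3 l w = 0 := by
  obtain ⟨c, hc⟩ := Projectivization.exists_smul_eq_mk_rep ℂ w hw
  rw [lineOf, Set.mem_ofPred_eq, ← hc, Units.smul_def, apply3_smul]
  simp

theorem mk_mem_curve {d : ℕ} {F : MvPolynomial (Fin 3) ℂ} (hF : F.IsHomogeneous d)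
    {w : Fin 3 → ℂ} (hw : w ≠ 0) : Projectivization.mk ℂ w hw ∈ curve F ↔ eval w F = 0 := by
  refine ⟨fun h => h w hw rfl, fun h w' hw' hww' => ?_⟩
  obtain ⟨c, rfl⟩ := (Projectivization.mk_eq_mk_iff' ℂ _ _ hw' hw).1 hww'
  have : IsForm d fun v => eval v F := ⟨F, hF, fun _ => rfl⟩
  rw [this.smul, h, mul_zero]

section
variable {l a b : Fin 3 → ℂ}

theorem eq_of_apply3_eq_zero (hl : l 2 ≠ 0) {v w : Fin 3 → ℂ} (hv : apply3 l v = 0)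
    (hw : apply3 l w = 0) (h0 : v 0 = w 0) (h1 : v 1 = w 1) : v = w := by
  have h2 : l 2 * v 2 = l 2 * w 2 := by
    simp only [apply3] at hv hw
    linear_combination hv - hw - l 0 * h0 - l 1 * h1
  ext i
  fin_cases i
  exacts [h0, h1, mul_left_cancel₀ hl h2]

theorem apply3_comb (ha : apply3 l a = 0) (hb : apply3 l b = 0) (s t : ℂ) :
    apply3 l (s • a + t • b) = 0 := by
  simp only [apply3, Pi.add_apply, Pi.smul_apply, smul_eq_mul] at *
  linear_combination s * ha + t * hb

theorem linearIndependent_iff_minor_ne_zero (hl : l 2 ≠ 0) (ha : apply3 l a = 0)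
    (hb : apply3 l b = 0) : LinearIndependent ℂ ![a, b] ↔ a 0 * b 1 - a 1 * b 0 ≠ 0 := by
  rw [LinearIndependent.pair_iff]
  refine ⟨fun h h0 => ?_, fun h s t hst => ?_⟩
  · have h1 := h (b 0) (-a 0) (eq_of_apply3_eq_zero hl (apply3_comb ha hb _ _) (apply3_zero l)
      (by simp; ring) (by simp; linear_combination -h0))
    have h2 := h (b 1) (-a 1) (eq_of_apply3_eq_zero hl (apply3_comb ha hb _ _) (apply3_zero l)
      (by simp; linear_combination h0) (by simp; ring))
    have h3 : a = 0 := eq_of_apply3_eq_zero hl ha (apply3_zero l) (by simpa using h1.2)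
      (by simpa using h2.2)
    exact one_ne_zero (h 1 0 (by simp [h3])).1
  · have h0 := congrFun hst 0
    have h1 := congrFun hst 1
    simp only [Pi.add_apply, Pi.smul_apply, smul_eq_mul, Pi.zero_apply] at h0 h1
    constructor
    · exact (mul_eq_zero.1 (by linear_combination b 1 * h0 - b 0 * h1 :
        s * (a 0 * b 1 - a 1 * b 0) = 0)).resolve_right h
    · exact (mul_eq_zero.1 (by linear_combination a 0 * h1 - a 1 * h0 :
        t * (a 0 * b 1 - a 1 * b 0) = 0)).resolve_right h

theorem eq_comb (hl : l 2 ≠ 0) (ha : apply3 l a = 0) (hb : apply3 l b = 0)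
    (hab : a 0 * b 1 - a 1 * b 0 ≠ 0) {w : Fin 3 → ℂ} (hw : apply3 l w = 0) :
    w = ((w 0 * b 1 - w 1 * b 0) / (a 0 * b 1 - a 1 * b 0)) • a +
      ((a 0 * w 1 - a 1 * w 0) / (a 0 * b 1 - a 1 * b 0)) • b := by
  refine eq_of_apply3_eq_zero hl hw (apply3_comb ha hb _ _) ?_ ?_ <;>
    simp only [Pi.add_apply, Pi.smul_apply, smul_eq_mul, div_mul_eq_mul_div, ← add_div] <;>
    rw [eq_div_iff hab] <;> ring

theorem lineThrough_eq_lineOf (hl : l 2 ≠ 0) (ha : apply3 l a = 0) (hb : apply3 l b = 0)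
    (hab : LinearIndependent ℂ ![a, b]) : lineThrough a b = lineOf l := by
  ext p
  constructor
  · rintro ⟨s, t, h, rfl⟩
    exact (mk_mem_lineOf h).2 (apply3_comb ha hb s t)
  · induction p using Projectivization.ind with | h w hw => ?_
    intro h
    rw [mk_mem_lineOf] at h
    have := eq_comb hl ha hb ((linearIndependent_iff_minor_ne_zero hl ha hb).1 hab) h
    refine ⟨_, _, this ▸ hw, ?_⟩
    congr 1

theorem apply3_eq_zero_of_lineOf_eq (hab : LinearIndependent ℂ ![a, b])
    (h : lineOf l = lineThrough a b) : apply3 l a = 0 ∧ apply3 l b = 0 := by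
  have ha : a ≠ 0 := hab.ne_zero 0
  have hb : b ≠ 0 := hab.ne_zero 1
  constructor
  · rw [← mk_mem_lineOf ha, h]
    exact ⟨1, 0, by simpa using ha, by simp⟩
  · rw [← mk_mem_lineOf hb, h]
    exact ⟨0, 1, by simpa using hb, by simp⟩

theorem exists_basis_lineOf (hl : l 2 ≠ 0) : ∃ a b : Fin 3 → ℂ, apply3 l a = 0 ∧ apply3 l b = 0 ∧
    LinearIndependent ℂ ![a, b] := by
  have ha : apply3 l ![1, 0, -l 0 / l 2] = 0 := by simp [apply3]; field_simp; ring
  have hb : apply3 l ![0, 1, -l 1 / l 2] = 0 := by simp [apply3]; field_simp; ring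
  exact ⟨_, _, ha, hb, (linearIndependent_iff_minor_ne_zero hl ha hb).2 (by simp)⟩

end

theorem eval_lineRest (F : MvPolynomial (Fin 3) ℂ) (a b : Fin 3 → ℂ) (t : ℂ) :
    (lineRest F a b).eval t = eval (a + t • b) F := by
  rw [lineRest, ← Polynomial.coe_evalRingHom, hom_eval₂]
  have : (Polynomial.evalRingHom t).comp Polynomial.C = RingHom.id ℂ := by ext x; simp
  rw [this, eval]
  congr 1
  funext i
  simp only [Polynomial.coe_evalRingHom, Polynomial.eval_add,
    Polynomial.eval_C, Polynomial.eval_mul, Polynomial.eval_X, Pi.add_apply, Pi.smul_apply,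
    smul_eq_mul]

/-- A form of positive degree has a nontrivial zero on every projective line. -/
theorem IsForm.exists_zero {d : ℕ} {f : (Fin 3 → ℂ) → ℂ} (hf : IsForm (d + 1) f)
    {a b : Fin 3 → ℂ} (hab : LinearIndependent ℂ ![a, b]) :
    ∃ s t : ℂ, s • a + t • b ≠ 0 ∧ f (s • a + t • b) = 0 := by
  rw [LinearIndependent.pair_iff] at hab
  by_cases hb : f b = 0
  · exact ⟨0, 1, fun h => one_ne_zero (hab _ _ h).2, by simpa using hb⟩
  obtain ⟨p, hp, hfp⟩ := id hf
  by_cases hdeg : (lineRest p a b).degree = 0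
  · exfalso
    have hc : lineRest p a b = Polynomial.C ((lineRest p a b).coeff 0) :=
      Polynomial.eq_C_of_degree_eq_zero hdeg
    set c := (lineRest p a b).coeff 0
    have h1 : Polynomial.X * (lineRest p b a - Polynomial.C c * Polynomial.X ^ (d + 1)) = 0 := by
      refine Polynomial.funext fun s => ?_
      by_cases hs : s = 0
      · simp [hs]
      · have h2 : b + s • a = s • (a + s⁻¹ • b) := by
          rw [smul_add, smul_smul, mul_inv_cancel₀ hs, one_smul, add_comm]
        have h3 : f (a + s⁻¹ • b) = c := by
          rw [hfp, ← eval_lineRest, hc, Polynomial.eval_C]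
        have h4 : (lineRest p b a).eval s = s ^ (d + 1) * c := by
          rw [eval_lineRest, ← hfp, h2, hf.smul, h3]
        simp [h4]
        right
        ring
    have h2 := sub_eq_zero.1 ((mul_eq_zero.1 h1).resolve_left Polynomial.X_ne_zero)
    have h3 := congrArg (Polynomial.eval 0) h2
    rw [eval_lineRest, ← hfp] at h3
    exact hb (by simpa using h3)
  · obtain ⟨t, ht⟩ := IsAlgClosed.exists_root (lineRest p a b) hdeg
    refine ⟨1, t, fun h => one_ne_zero (hab _ _ h).1, ?_⟩
    rwa [one_smul, hfp, ← eval_lineRest]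

/-- A smooth curve contains no line. -/
theorem SmoothCurve.not_vanish_on_line {F : MvPolynomial (Fin 3) ℂ} (hF : F.IsHomogeneous 4)
    (hs : SmoothCurve F) {l : Fin 3 → ℂ} (hl : l 2 ≠ 0) :
    ¬ ∀ v, apply3 l v = 0 → eval v F = 0 := by
  intro h
  have hdet : det3 l ![1, 0, 0] ![0, 1, 0] ≠ 0 := by simpa [det3] using hl
  obtain ⟨g, ⟨q, hq, hgq⟩, hFg⟩ := IsForm.exists_eq_line_mul (d := 3) hdet ⟨F, hF, fun _ => rfl⟩ h
  obtain ⟨m, hm, hlm⟩ := isForm_apply3 l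
  have hFmq : F = m * q := MvPolynomial.funext fun v => by rw [hFg, map_mul, hlm, hgq]
  obtain ⟨a, b, ha, hb, hab⟩ := exists_basis_lineOf hl
  obtain ⟨s, t, hst, h0⟩ := IsForm.exists_zero (d := 2) ⟨q, hq, hgq⟩ hab
  have h1 := apply3_comb ha hb s t
  rw [hgq] at h0
  rw [hlm] at h1
  refine hs _ hst ⟨by rw [hFmq, map_mul, h0, mul_zero], fun i => ?_⟩
  rw [hFmq, Derivation.leibniz, map_add, smul_eq_mul, smul_eq_mul, map_mul, map_mul, h0, h1]
  simp

/-- The equation of a smooth curve is not a square. -/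
theorem SmoothCurve.not_sq {F : MvPolynomial (Fin 3) ℂ} (hs : SmoothCurve F) :
    ¬ ∃ Q, IsForm 2 Q ∧ ∀ v, eval v F = Q v ^ 2 := by
  rintro ⟨Q, ⟨q, hq, hQq⟩, hF⟩
  have hFq : F = q ^ 2 := MvPolynomial.funext fun v => by rw [hF, map_pow, hQq]
  obtain ⟨a, b, -, -, hab⟩ := exists_basis_lineOf (l := ![0, 0, 1]) (by simp)
  obtain ⟨s, t, hst, h0⟩ := IsForm.exists_zero (d := 1) ⟨q, hq, hQq⟩ hab
  rw [hQq] at h0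
  refine hs _ hst ⟨by rw [hFq, map_pow, h0]; simp, fun i => ?_⟩
  rw [hFq, sq, Derivation.leibniz, map_add, smul_eq_mul, map_mul, h0]
  simp

theorem IsForm.exists_binary {f : (Fin 3 → ℂ) → ℂ} (hf : IsForm 4 f) (a b : Fin 3 → ℂ) :
    ∃ k : ℕ → ℂ, ∀ x y : ℂ, f (x • a + y • b) = k 0 * x ^ 4 + k 1 * (x ^ 3 * y)
      + k 2 * (x ^ 2 * y ^ 2) + k 3 * (x * y ^ 3) + k 4 * y ^ 4 := by
  let T : (Fin 3 → ℂ) →ₗ[ℂ] (Fin 3 → ℂ) :=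
    (LinearMap.proj 0 : (Fin 3 → ℂ) →ₗ[ℂ] ℂ).smulRight a +
      (LinearMap.proj 1 : (Fin 3 → ℂ) →ₗ[ℂ] ℂ).smulRight b
  obtain ⟨c, hc⟩ := (hf.comp T).exists_coeff
  refine ⟨fun i => c (4 - i) i, fun x y => ?_⟩
  have := hc ![x, y, 0]
  simp only [T, LinearMap.add_apply, LinearMap.smulRight_apply, LinearMap.proj_apply] at this
  simp [Finset.sum_range_succ] at this
  rw [this]
  ring

/-- A quartic polynomial without simple roots is a square. -/
theorem exists_sq_of_rootMultiplicity {R : Polynomial ℂ} (hR : R.natDegree = 4)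
    (h : ∀ t, R.IsRoot t → 2 ≤ R.rootMultiplicity t) :
    ∃ e₀ e₁ e₂ : ℂ, ∀ t, R.eval t = (e₀ + e₁ * t + e₂ * t ^ 2) ^ 2 := by
  have hsplit := IsAlgClosed.splits R
  have hcard : R.roots.card = 4 := by
    rw [← hR]; exact hsplit.natDegree_eq_card_roots.symm
  have hcount : ∀ t ∈ R.roots, 2 ≤ R.roots.count t := fun t ht => by
    rw [Polynomial.count_roots]
    exact h t (Polynomial.isRoot_of_mem_roots ht)
  obtain ⟨α, β, hαβ⟩ : ∃ α β, R.roots = {α, α, β, β} := by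
    obtain ⟨α, hα⟩ := Multiset.card_pos_iff_exists_mem.1 (by omega : 0 < R.roots.card)
    obtain ⟨s, hs⟩ := Multiset.le_iff_exists_add.1 (Multiset.le_count_iff_replicate_le.1 (hcount α hα))
    rw [hs, Multiset.card_add, Multiset.card_replicate] at hcard
    obtain ⟨β, γ, rfl⟩ := Multiset.card_eq_two.1 (by omega : s.card = 2)
    have hβ := hcount β (by simp [hs])
    have hγ := hcount γ (by simp [hs])
    simp only [hs, Multiset.count_add, Multiset.count_replicate, Multiset.insert_eq_cons,
      Multiset.count_cons, Multiset.count_singleton] at hβ hγ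
    by_cases hβγ : β = γ
    · exact ⟨α, β, by rw [hs, hβγ]; rfl⟩
    · exfalso
      split_ifs at hβ hγ <;> simp_all
  obtain ⟨c, hc⟩ := IsAlgClosed.exists_pow_nat_eq R.leadingCoeff (n := 2) (by norm_num)
  have hprod := hsplit.eq_prod_roots
  rw [hαβ] at hprod
  refine ⟨c * (α * β), -c * (α + β), c, fun t => ?_⟩
  rw [hprod, ← hc]
  simp
  ring

/-- Along a bitangent, the equation of the curve is a square. -/
theorem Bitangent.exists_eq_quad_sq {F : MvPolynomial (Fin 3) ℂ} (hF : F.IsHomogeneous 4)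
    {l : Fin 3 → ℂ} (hl : l 2 ≠ 0) (h : Bitangent F (lineOf l)) :
    ∃ q : Fin 3 → ℂ, ∀ v, apply3 l v = 0 → eval v F = quad q v ^ 2 := by
  obtain ⟨-, hnot, htan⟩ := h
  obtain ⟨p, hp, hpF⟩ := Set.not_subset.1 hnot
  induction p using Projectivization.ind with | h b hb => ?_
  rw [mk_mem_lineOf] at hp
  rw [mk_mem_curve hF] at hpF
  obtain ⟨a, ha, hab⟩ : ∃ a, apply3 l a = 0 ∧ LinearIndependent ℂ ![a, b] := by
    obtain ⟨u, v, hu, hv, huv⟩ := exists_basis_lineOf hl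
    by_contra! hcon
    have h1 := hcon u hu
    have h2 := hcon v hv
    rw [linearIndependent_iff_minor_ne_zero hl hu hp, not_not] at h1
    rw [linearIndependent_iff_minor_ne_zero hl hv hp, not_not] at h2
    rw [linearIndependent_iff_minor_ne_zero hl hu hv] at huv
    refine hb (eq_of_apply3_eq_zero hl hp (apply3_zero l) ?_ ?_)
    · exact (mul_eq_zero.1 (by linear_combination v 0 * h1 - u 0 * h2 :
        b 0 * (u 0 * v 1 - u 1 * v 0) = 0)).resolve_right huv
    · exact (mul_eq_zero.1 (by linear_combination v 1 * h1 - u 1 * h2 :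
        b 1 * (u 0 * v 1 - u 1 * v 0) = 0)).resolve_right huv
  obtain ⟨k, hk⟩ := IsForm.exists_binary (f := fun v => eval v F) ⟨F, hF, fun _ => rfl⟩ a b
  have hk4 : k 4 ≠ 0 := by
    have := hk 0 1
    simp only [zero_smul, one_smul, zero_add] at this
    rw [this] at hpF
    simpa using hpF
  set R := lineRest F a b with hR
  have hReval : ∀ t, R.eval t = k 0 + k 1 * t + k 2 * t ^ 2 + k 3 * t ^ 3 + k 4 * t ^ 4 :=
    fun t => by
      rw [hR, eval_lineRest]
      have := hk 1 t
      simp only [one_smul] at this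
      rw [this]
      ring
  have hdeg : R.natDegree = 4 := by
    have : R = Polynomial.C (k 4) * Polynomial.X ^ 4 + Polynomial.C (k 3) * Polynomial.X ^ 3 +
        Polynomial.C (k 2) * Polynomial.X ^ 2 + Polynomial.C (k 1) * Polynomial.X +
        Polynomial.C (k 0) := Polynomial.funext fun t => by
      rw [hReval]
      simp
      ring
    rw [this]
    compute_degree!
  obtain ⟨e₀, e₁, e₂, he⟩ := exists_sq_of_rootMultiplicity hdeg fun t ht => by
    have hind : LinearIndependent ℂ ![a + t • b, b] := by
      have hat : apply3 l (a + t • b) = 0 := by simpa using apply3_comb ha hp 1 t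
      rw [linearIndependent_iff_minor_ne_zero hl ha hp] at hab
      rw [linearIndependent_iff_minor_ne_zero hl hat hp]
      simp only [Pi.add_apply, Pi.smul_apply, smul_eq_mul]
      convert hab using 1
      ring
    have hat : apply3 l (a + t • b) = 0 := by simpa using apply3_comb ha hp 1 t
    have h0 : a + t • b ≠ 0 := hind.ne_zero 0
    have h1 := htan _ _ hind (lineThrough_eq_lineOf hl hat hp hind).symm h0
      ((mk_mem_curve hF h0).2 (by rw [← eval_lineRest]; exact ht))
    have h2 : lineRest F (a + t • b) b = R.comp (Polynomial.X + Polynomial.C t) :=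
      Polynomial.funext fun s => by
        rw [eval_lineRest, Polynomial.eval_comp, hR, eval_lineRest]
        simp [add_smul, add_assoc, add_comm]
    rwa [multAt, h2, ← Polynomial.rootMultiplicity_eq_rootMultiplicity] at h1
  have hsq : ∀ x y, eval (x • a + y • b) F = (e₀ * x ^ 2 + e₁ * (x * y) + e₂ * y ^ 2) ^ 2 := by
    intro x y
    have hRe : ∀ t, k 0 + k 1 * t + k 2 * t ^ 2 + k 3 * t ^ 3 + k 4 * t ^ 4 =
      (e₀ + e₁ * t + e₂ * t ^ 2) ^ 2 := fun t => by rw [← he, hReval]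
    rw [hk]
    have c0 := hRe 0
    have c1 := hRe 1
    have c2 := hRe (-1)
    have c3 := hRe 2
    have c4 := hRe (-2)
    have d0 : k 0 = e₀ ^ 2 := by linear_combination c0
    have d4 : k 4 = e₂ ^ 2 := by
      linear_combination (c3 + c4 - 4 * c1 - 4 * c2 + 6 * c0) / 24
    have d2 : k 2 = 2 * e₀ * e₂ + e₁ ^ 2 := by
      linear_combination (c1 + c2) / 2 - d0 - d4
    have d3 : k 3 = 2 * e₁ * e₂ := by
      linear_combination (c3 - c4 - 2 * c1 + 2 * c2) / 12
    have d1 : k 1 = 2 * e₀ * e₁ := by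
      linear_combination (c1 - c2) / 2 - d3
    rw [d0, d1, d2, d3, d4]
    ring
  set D := a 0 * b 1 - a 1 * b 0 with hD
  have hD0 : D ≠ 0 := (linearIndependent_iff_minor_ne_zero hl ha hp).1 hab
  let x : (Fin 3 → ℂ) → ℂ := fun w => D⁻¹ * (b 1 * w 0 + -b 0 * w 1)
  let y : (Fin 3 → ℂ) → ℂ := fun w => D⁻¹ * (-a 1 * w 0 + a 0 * w 1)
  have hx : IsForm 1 x := (((IsForm.coord 0).const_mul _).add ((IsForm.coord 1).const_mul _)).const_mul _
  have hy : IsForm 1 y := (((IsForm.coord 0).const_mul _).add ((IsForm.coord 1).const_mul _)).const_mul _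
  have hQ : IsForm 2 fun w => e₀ * x w ^ 2 + e₁ * (x w * y w) + e₂ * y w ^ 2 :=
    ((hx.sq.const_mul _).add ((hx.mul hy).const_mul _)).add (hy.sq.const_mul _)
  obtain ⟨q, hq⟩ := hQ.exists_eq_quad hl
  refine ⟨q, fun v hv => ?_⟩
  rw [← hq v hv, ← hsq]
  have hxv : x v = (v 0 * b 1 - v 1 * b 0) / D := by simp only [x]; field_simp; ring
  have hyv : y v = (a 0 * v 1 - a 1 * v 0) / D := by simp only [y]; field_simp; ring
  rw [hxv, hyv, ← eq_comb hl ha hp hD0 hv]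

/-- A line along which the equation of a smooth quartic is a square is a bitangent. -/
theorem SmoothCurve.bitangent {F : MvPolynomial (Fin 3) ℂ} (hF : F.IsHomogeneous 4)
    (hs : SmoothCurve F) {l : Fin 3 → ℂ} (hl : l 2 ≠ 0) {q : Fin 3 → ℂ}
    (h : ∀ v, apply3 l v = 0 → eval v F = quad q v ^ 2) : Bitangent F (lineOf l) := by
  obtain ⟨u, v, hu, hv, huv⟩ := exists_basis_lineOf hl
  refine ⟨⟨u, v, huv, (lineThrough_eq_lineOf hl hu hv huv).symm⟩, fun hsub => ?_, ?_⟩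
  · refine hs.not_vanish_on_line hF hl fun w hw => ?_
    by_cases hw0 : w = 0
    · rw [hw0, h 0 (apply3_zero l)]
      simp [quad]
    · exact (mk_mem_curve hF hw0).1 (hsub ((mk_mem_lineOf hw0).2 hw))
  · intro a b hab hS ha hcurve
    obtain ⟨ha', hb'⟩ := apply3_eq_zero_of_lineOf_eq hab hS
    rw [mk_mem_curve hF, h a ha', sq_eq_zero_iff] at hcurve
    have hR : lineRest F a b = (Polynomial.X * (Polynomial.C (2 * q 0 * a 0 * b 0 +
        q 1 * (a 0 * b 1 + a 1 * b 0) + 2 * q 2 * a 1 * b 1) +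
        Polynomial.C (quad q b) * Polynomial.X)) ^ 2 := Polynomial.funext fun t => by
      rw [eval_lineRest, h _ (by simpa using apply3_comb ha' hb' 1 t)]
      simp only [Polynomial.eval_pow, Polynomial.eval_mul, Polynomial.eval_add, Polynomial.eval_X,
        Polynomial.eval_C]
      congr 1
      simp only [quad, Pi.add_apply, Pi.smul_apply, smul_eq_mul] at hcurve ⊢
      linear_combination hcurve
    have hR0 : lineRest F a b ≠ 0 := by
      intro h0
      rw [hR, sq_eq_zero_iff] at h0
      have h1 := (mul_eq_zero.1 h0).resolve_left Polynomial.X_ne_zero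
      have h2 := congrArg (Polynomial.eval 0) h1
      have h3 := congrArg (Polynomial.eval 1) h1
      simp only [Polynomial.eval_mul, Polynomial.eval_add, Polynomial.eval_X, Polynomial.eval_C,
        mul_zero, add_zero, mul_one, Polynomial.eval_zero] at h2 h3
      rw [h2, zero_add] at h3
      refine hs.not_vanish_on_line hF hl fun w hw => ?_
      rw [eq_comb hl ha' hb' ((linearIndependent_iff_minor_ne_zero hl ha' hb').1 hab) hw,
        h _ (apply3_comb ha' hb' _ _), sq_eq_zero_iff]
      generalize (w 0 * b 1 - w 1 * b 0) / (a 0 * b 1 - a 1 * b 0) = x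
      generalize (a 0 * w 1 - a 1 * w 0) / (a 0 * b 1 - a 1 * b 0) = y
      simp only [quad, Pi.add_apply, Pi.smul_apply, smul_eq_mul] at hcurve h3 ⊢
      linear_combination x ^ 2 * hcurve + x * y * h2 + y ^ 2 * h3
    rw [multAt, Polynomial.le_rootMultiplicity_iff hR0, hR, map_zero, sub_zero, mul_pow]
    exact dvd_mul_right _ _

/-- The exponents of the monomials of degree four. -/
def quarticExpoFun : Fin 15 → Fin 3 → ℕ :=
  ![![0, 0, 4], ![0, 1, 3], ![0, 2, 2], ![0, 3, 1], ![0, 4, 0], ![1, 0, 3], ![1, 1, 2], ![1, 2, 1],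
    ![1, 3, 0], ![2, 0, 2], ![2, 1, 1], ![2, 2, 0], ![3, 0, 1], ![3, 1, 0], ![4, 0, 0]]

def quarticExpo (m : Fin 15) : Fin 3 →₀ ℕ := Finsupp.equivFunOnFinite.symm (quarticExpoFun m)

theorem quarticExpo_injective : Function.Injective quarticExpo :=
  Finsupp.equivFunOnFinite.symm.injective.comp (by decide : Function.Injective quarticExpoFun)

theorem degree_quarticExpo (m : Fin 15) : (quarticExpo m).degree = 4 := by
  rw [Finsupp.degree_eq_sum]
  exact (by decide : ∀ m, ∑ i, quarticExpoFun m i = 4) m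

theorem eval_eq_quarticForm {F : MvPolynomial (Fin 3) ℂ} (hF : F.IsHomogeneous 4)
    (v : Fin 3 → ℂ) : eval v F = quarticForm (fun m => coeff (quarticExpo m) F) v := by
  rw [IsForm.eval_eq_sum hF]
  simp [Finset.sum_range_succ, quarticForm, quarticExpo, quarticExpoFun, expo]
  ring

theorem quarticForm_smul (t : ℂ) (c : Fin 15 → ℂ) (v : Fin 3 → ℂ) :
    quarticForm (fun m => t * c m) v = t * quarticForm c v := by
  simp only [quarticForm]
  ring

theorem exists_smul_eval_ne_zero {κ : Type*} [Fintype κ] (P : MvPolynomial κ ℂ) (k : ℕ)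
    {y : κ → ℂ} (hy : eval y (homogeneousComponent k P) ≠ 0) :
    ∃ t : ℂ, t ≠ 0 ∧ eval (fun m => t * y m) P ≠ 0 := by
  have hk : k ∈ Finset.range (P.totalDegree + 1) := by
    rw [Finset.mem_range, Nat.lt_succ_iff]
    by_contra! h
    exact hy (by rw [homogeneousComponent_eq_zero _ _ h, map_zero])
  set q : Polynomial ℂ := ∑ i ∈ Finset.range (P.totalDegree + 1),
    Polynomial.C (eval y (homogeneousComponent i P)) * Polynomial.X ^ i with hq
  have hqk : q.coeff k ≠ 0 := by
    rw [hq, Polynomial.finsetSum_coeff, Finset.sum_eq_single_of_mem k hk]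
    · simpa using hy
    · intro i _ hi
      rw [Polynomial.coeff_C_mul_X_pow, if_neg (Ne.symm hi)]
  have hq0 : Polynomial.X * q ≠ 0 :=
    mul_ne_zero Polynomial.X_ne_zero fun h => hqk (by rw [h, Polynomial.coeff_zero])
  obtain ⟨t, ht⟩ : ∃ t, (Polynomial.X * q).eval t ≠ 0 := by
    by_contra! h
    exact hq0 (Polynomial.funext fun t => by rw [h, Polynomial.eval_zero])
  rw [Polynomial.eval_mul, Polynomial.eval_X] at ht
  refine ⟨t, left_ne_zero_of_mul ht, ?_⟩
  convert right_ne_zero_of_mul ht using 1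
  conv_lhs => rw [← sum_homogeneousComponent P]
  rw [map_sum, hq, Polynomial.eval_finsetSum]
  refine Finset.sum_congr rfl fun i _ => ?_
  have hi := homogeneousComponent_isHomogeneous i P
  simp only [Polynomial.eval_mul, Polynomial.eval_C, Polynomial.eval_pow, Polynomial.eval_X]
  rw [eval_eq', eval_eq', Finset.sum_mul]
  refine Finset.sum_congr rfl fun d hd => ?_
  have : ∑ j, d j = i := by
    rw [← Finsupp.degree_eq_sum]
    exact (hi.degree_eq_sum_deg_support hd).symm
  simp only [mul_pow, Finset.prod_mul_distrib, Finset.prod_pow_eq_pow_sum, this]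
  ring

/-- There is a proper Zariski-closed subset `Z` of the `ℙ¹⁴` of plane
quartics (here: the zero locus of a homogeneous polynomial `P` in the coefficients, not
vanishing identically on quartic forms) such that every smooth plane quartic outside `Z`
is uniquely determined, among smooth plane quartics, by its set of 28 bitangent lines. -/
theorem general_smooth_quartic_determined_by_bitangents :
    ∃ (P : MvPolynomial ((Fin 3) →₀ ℕ) ℂ) (k : ℕ), P.IsHomogeneous k ∧
      (∃ F₀ : MvPolynomial (Fin 3) ℂ, F₀ ≠ 0 ∧ F₀.IsHomogeneous 4 ∧
        eval (fun m => coeff m F₀) P ≠ 0) ∧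
      ∀ F G : MvPolynomial (Fin 3) ℂ,
        F ≠ 0 → F.IsHomogeneous 4 → SmoothCurve F →
        eval (fun m => coeff m F) P ≠ 0 →
        G ≠ 0 → G.IsHomogeneous 4 → SmoothCurve G →
        {S : Set P2 | Bitangent G S} = {S : Set P2 | Bitangent F S} →
        ∃ c : ℂ, c ≠ 0 ∧ G = c • F := by
  obtain ⟨h, hh, hθ⟩ := (generic_goodLines.and generic_edgeCov_ne_zero).and generic_det4_octadPt
  obtain ⟨P, hP, hPy⟩ := exists_principal_open_subset_image _ aeval_quarticCoeff_ne_zero hh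
  obtain ⟨k, hk⟩ : ∃ k, homogeneousComponent k P ≠ 0 := by
    by_contra! h0
    exact hP (by rw [← sum_homogeneousComponent P]; exact Finset.sum_eq_zero fun i _ => h0 i)
  refine ⟨rename quarticExpo (homogeneousComponent k P), k,
    (homogeneousComponent_isHomogeneous k P).rename_isHomogeneous, ?_, ?_⟩
  · obtain ⟨y, hy⟩ : ∃ y, eval y (homogeneousComponent k P * X 0) ≠ 0 := by
      by_contra! h0
      exact mul_ne_zero hk (X_ne_zero 0) (MvPolynomial.funext fun y => by rw [h0, map_zero])
    rw [map_mul, eval_X] at hy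
    let F₀ : MvPolynomial (Fin 3) ℂ := ∑ m, monomial (quarticExpo m) (y m)
    have hF₀ : ∀ m, coeff (quarticExpo m) F₀ = y m := fun m => by
      simp [F₀, coeff_sum, coeff_monomial, quarticExpo_injective.eq_iff]
    refine ⟨F₀, fun h0 => right_ne_zero_of_mul hy ?_,
      IsHomogeneous.sum _ _ _ fun m _ => isHomogeneous_monomial _ (degree_quarticExpo m), ?_⟩
    · rw [← hF₀, h0, coeff_zero]
    · rw [eval_rename]
      convert left_ne_zero_of_mul hy using 3
      exact _root_.funext hF₀
  · intro F G _ hF hFs hFP _ hG hGs hFG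
    rw [eval_rename] at hFP
    obtain ⟨t, ht, htP⟩ := exists_smul_eval_ne_zero P k hFP
    obtain ⟨θ, hhθ, hθF⟩ := hPy _ htP
    obtain ⟨⟨hL, h2⟩, hd⟩ := hθ θ hhθ
    obtain ⟨q, hq⟩ := exists_squareOn h2 hd
    have hθF' : quarticCoeff θ = fun m => t * coeff (quarticExpo m) F :=
        _root_.funext fun m => by
      have hX : (eval θ : MvPolynomial (Fin 18) ℂ →+* ℂ) ∘ X = θ := _root_.funext fun i => eval_X i
      have := hθF m
      rwa [← map_quarticCoeff, hX] at this
    obtain ⟨μ, hμ⟩ := IsAlgClosed.exists_pow_nat_eq t⁻¹ (n := 2) (by norm_num)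
    have hqF : SquareOn (edgeCov θ) (fun v => eval v F) fun e => μ • q e := fun e v hv => by
      have := hq e v hv
      rw [hθF', quarticForm_smul, ← eval_eq_quarticForm hF] at this
      rw [quad_smul_left, mul_pow, hμ, ← this, inv_mul_cancel_left₀ ht]
    have hbit : ∀ e, Bitangent G (lineOf (edgeCov θ e)) := fun e => by
      have : lineOf (edgeCov θ e) ∈ {S : Set P2 | Bitangent F S} :=
        hFs.bitangent hF (h2 e) (hqF e)
      rwa [← hFG] at this
    choose r hr using fun e => (hbit e).exists_eq_quad_sq hG (h2 e)
    obtain ⟨c, hc, hcG⟩ := hL.proportional ⟨F, hF, fun _ => rfl⟩ ⟨G, hG, fun _ => rfl⟩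
      hFs.not_sq hGs.not_sq hqF hr
    exact ⟨c, hc, MvPolynomial.funext fun v => by rw [hcG, smul_eval]⟩

end
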